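/- There exists a unital C*-algebra A which is separable and simple (its only closed two-sided ideals are {0} and A) and which admits no conjugate-linear *-automorphism: there is no bijective map φ : A → A that is ℝ-linear, satisfies φ(xy) = φ(x)φ(y) and φ(x*) = φ(x)* for all x, y ∈ A, and satisfies φ(c • x) = (conjugate of c) • φ(x) for all c ∈ ℂ and x ∈ A. In particular, A is not isomorphic to the complexification of any real C*-algebra. -/

import Mathlib

namespace TwistedGroup

open scoped ComplexConjugate InnerProductSpace

/-- The Hilbert space of square-summable complex functions on `G`. -/
abbrev L2 (G : Type) : Type := lp (fun _ : G => ℂ) 2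

section Basic

variable {G : Type}

theorem L2.summable_norm_sq (ξ : L2 G) : Summable fun x => ‖ξ x‖ ^ 2 := by
  have h := (lp.memℓp ξ).summable (by norm_num)
  simpa using h

theorem L2.norm_sq_eq (ξ : L2 G) : ‖ξ‖ ^ 2 = ∑' x, ‖ξ x‖ ^ 2 := by
  have h := lp.norm_rpow_eq_tsum (p := 2) (by norm_num) ξ
  simpa using h

theorem L2.memℓp_two {f : G → ℂ} (hf : Summable fun x => ‖f x‖ ^ 2) :
    Memℓp (E := fun _ : G => ℂ) f 2 := by
  apply memℓp_gen
  simpa using hf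

theorem L2.norm_le_of_apply_le {ξ η : L2 G} (e : G ≃ G) (h : ∀ x, ‖ξ x‖ ≤ ‖η (e x)‖) :
    ‖ξ‖ ≤ ‖η‖ := by
  have h1 : ‖ξ‖ ^ 2 ≤ ‖η‖ ^ 2 := by
    rw [L2.norm_sq_eq, L2.norm_sq_eq, ← e.tsum_eq (fun x => ‖η x‖ ^ 2)]
    refine (L2.summable_norm_sq ξ).tsum_le_tsum (fun x => ?_)
      ((e.summable_iff (f := fun x => ‖η x‖ ^ 2)).2 (L2.summable_norm_sq η))
    exact pow_le_pow_left₀ (norm_nonneg _) (h x) 2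
  exact (sq_le_sq₀ (norm_nonneg _) (norm_nonneg _)).1 h1

/-- The weighted composition operator `ξ ↦ m · (ξ ∘ e)` on `ℓ²(G)`. -/
noncomputable def wop (e : G ≃ G) (m : G → ℂ) (hm : ∀ x, ‖m x‖ ≤ 1) : L2 G →L[ℂ] L2 G :=
  LinearMap.mkContinuous
    { toFun := fun ξ => ⟨fun x => m x * ξ (e x), by
        refine L2.memℓp_two (Summable.of_nonneg_of_le (fun _ => by positivity) (fun x => ?_)
          ((e.summable_iff (f := fun x => ‖ξ x‖ ^ 2)).2 (L2.summable_norm_sq ξ)))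
        refine pow_le_pow_left₀ (norm_nonneg _) ?_ 2
        rw [norm_mul]
        exact mul_le_of_le_one_left (norm_nonneg _) (hm x)⟩
      map_add' := fun ξ η => by
        ext x
        simp only [lp.coeFn_add, Pi.add_apply, mul_add]
      map_smul' := fun c ξ => by
        ext x
        simp only [lp.coeFn_smul, Pi.smul_apply, smul_eq_mul, RingHom.id_apply]
        ring } 1
    (fun ξ => by
      rw [one_mul]
      refine L2.norm_le_of_apply_le e fun x => ?_
      show ‖m x * ξ (e x)‖ ≤ _
      rw [norm_mul]
      exact mul_le_of_le_one_left (norm_nonneg _) (hm x))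

@[simp]
theorem wop_apply (e : G ≃ G) (m : G → ℂ) (hm : ∀ x, ‖m x‖ ≤ 1) (ξ : L2 G) (x : G) :
    wop e m hm ξ x = m x * ξ (e x) := rfl

theorem star_wop (e : G ≃ G) (m : G → ℂ) (hm : ∀ x, ‖m x‖ ≤ 1) :
    star (wop e m hm) = wop e.symm (fun x => conj (m (e.symm x))) (by simpa using fun x => hm _) := by
  rw [ContinuousLinearMap.star_eq_adjoint, eq_comm, ContinuousLinearMap.eq_adjoint_iff]
  intro ξ η
  rw [lp.inner_eq_tsum, lp.inner_eq_tsum, ← e.tsum_eq (fun x => _)]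
  refine tsum_congr fun x => ?_
  simp only [wop_apply, Equiv.symm_apply_apply, RCLike.inner_apply, map_mul, Complex.conj_conj]
  ring

/-- The restriction operator to the subset `S`. -/
noncomputable def res (S : Set G) : L2 G →L[ℂ] L2 G :=
  wop (Equiv.refl G) (S.indicator 1) (fun x => by
    by_cases h : x ∈ S <;> simp [h])

open Classical in
theorem res_apply (S : Set G) (ξ : L2 G) (x : G) : res S ξ x = if x ∈ S then ξ x else 0 := by
  simp [res, Set.indicator_apply]

theorem res_apply_of_mem {S : Set G} {x : G} (h : x ∈ S) (ξ : L2 G) : res S ξ x = ξ x := by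
  simp [res_apply, h]

theorem res_apply_of_notMem {S : Set G} {x : G} (h : x ∉ S) (ξ : L2 G) : res S ξ x = 0 := by
  simp [res_apply, h]

theorem norm_res_le (S : Set G) (ξ : L2 G) : ‖res S ξ‖ ≤ ‖ξ‖ := by
  refine L2.norm_le_of_apply_le (Equiv.refl G) fun x => ?_
  by_cases h : x ∈ S <;> simp [res_apply, h]

theorem star_res (S : Set G) : star (res S) = res S := by
  rw [res, star_wop]
  ext ξ x
  by_cases h : x ∈ S <;> simp [h]

theorem res_univ (ξ : L2 G) : res Set.univ ξ = ξ := by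
  ext x; simp [res_apply]

theorem sum_norm_res_sq_le {ι : Type*} (s : Finset ι) (S : ι → Set G)
    (hd : (s : Set ι).PairwiseDisjoint S) (T : Set G) (hT : ∀ i ∈ s, S i ⊆ T) (ξ : L2 G) :
    ∑ i ∈ s, ‖res (S i) ξ‖ ^ 2 ≤ ‖res T ξ‖ ^ 2 := by
  classical
  simp only [L2.norm_sq_eq]
  rw [← Summable.tsum_finsetSum (fun i _ => L2.summable_norm_sq _)]
  refine Summable.tsum_le_tsum (fun x => ?_) (summable_sum fun i _ => L2.summable_norm_sq _)
    (L2.summable_norm_sq _)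
  by_cases hx : ∃ i ∈ s, x ∈ S i
  · obtain ⟨i, hi, hxi⟩ := hx
    rw [Finset.sum_eq_single_of_mem i hi, res_apply_of_mem hxi, res_apply_of_mem (hT i hi hxi)]
    intro j hj hji
    rw [res_apply_of_notMem, norm_zero, zero_pow two_ne_zero]
    exact fun hxj => Set.disjoint_left.1 (hd hj hi hji) hxj hxi
  · push Not at hx
    rw [Finset.sum_eq_zero]
    · positivity
    · intro i hi
      rw [res_apply_of_notMem (hx i hi), norm_zero, zero_pow two_ne_zero]

theorem norm_res_union_sq_le (S T : Set G) (ξ : L2 G) :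
    ‖res (S ∪ T) ξ‖ ^ 2 ≤ ‖res S ξ‖ ^ 2 + ‖res T ξ‖ ^ 2 := by
  simp only [L2.norm_sq_eq]
  rw [← (L2.summable_norm_sq _).tsum_add (L2.summable_norm_sq _)]
  refine Summable.tsum_le_tsum (fun x => ?_) (L2.summable_norm_sq _)
    ((L2.summable_norm_sq _).add (L2.summable_norm_sq _))
  by_cases h1 : x ∈ S <;> by_cases h2 : x ∈ T <;> simp [res_apply, h1, h2]

end Basic

section Regular

variable {G : Type} [Group G] (σ : G →* G →* Circle)

/-- The left regular representation twisted by the bicharacter `σ`. -/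
noncomputable def lam (g : G) : L2 G →L[ℂ] L2 G :=
  wop (Equiv.mulLeft g⁻¹) (fun x => σ g (g⁻¹ * x)) (fun _ => (Circle.norm_coe _).le)

/-- The right regular representation twisted by the bicharacter `σ`. -/
noncomputable def rho (g : G) : L2 G →L[ℂ] L2 G :=
  wop (Equiv.mulRight g⁻¹) (fun x => σ (x * g⁻¹) g) (fun _ => (Circle.norm_coe _).le)

theorem lam_apply (g : G) (ξ : L2 G) (x : G) :
    lam σ g ξ x = σ g (g⁻¹ * x) * ξ (g⁻¹ * x) := rfl

theorem rho_apply (g : G) (ξ : L2 G) (x : G) :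
    rho σ g ξ x = σ (x * g⁻¹) g * ξ (x * g⁻¹) := rfl

theorem lam_one : lam σ 1 = 1 := by
  ext ξ x; simp [lam_apply]

theorem rho_one : rho σ 1 = 1 := by
  ext ξ x; simp [rho_apply]

theorem lam_mul (g k : G) : lam σ g * lam σ k = (σ g k : ℂ) • lam σ (g * k) := by
  ext ξ x
  simp only [mul_apply_eq_comp, lam_apply, smul_apply,
    lp.coeFn_smul, Pi.smul_apply, smul_eq_mul, map_mul, MonoidHom.mul_apply, mul_inv_rev, map_inv,
    Circle.coe_mul, Circle.coe_inv, mul_assoc]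
  have h1 : (σ g k : ℂ) ≠ 0 := Circle.coe_ne_zero _
  field_simp

theorem rho_mul (g h : G) : rho σ g * rho σ h = (σ h g : ℂ) • rho σ (h * g) := by
  ext ξ x
  simp only [mul_apply_eq_comp, rho_apply, smul_apply,
    lp.coeFn_smul, Pi.smul_apply, smul_eq_mul, map_mul, MonoidHom.mul_apply, mul_inv_rev, map_inv,
    MonoidHom.inv_apply, Circle.coe_mul, Circle.coe_inv, mul_assoc]
  have h1 : (σ h g : ℂ) ≠ 0 := Circle.coe_ne_zero _
  field_simp

theorem lam_rho (g h : G) (ξ : L2 G) : lam σ g (rho σ h ξ) = rho σ h (lam σ g ξ) := by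
  ext x
  simp only [rho_apply, lam_apply, map_mul, MonoidHom.mul_apply, map_inv,
    MonoidHom.inv_apply, Circle.coe_mul, Circle.coe_inv, mul_assoc]
  ring

theorem star_lam (g : G) : star (lam σ g) = (σ g g : ℂ) • lam σ g⁻¹ := by
  rw [lam, star_wop]
  ext ξ x
  have h1 : (σ g g : ℂ) ≠ 0 := Circle.coe_ne_zero _
  simp [lam_apply, ← Circle.coe_inv_eq_conj]
  field_simp

theorem star_rho (g : G) : star (rho σ g) = (σ g g : ℂ) • rho σ g⁻¹ := by
  rw [rho, star_wop]
  ext ξ x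
  have h1 : (σ g g : ℂ) ≠ 0 := Circle.coe_ne_zero _
  simp [rho_apply, ← Circle.coe_inv_eq_conj]
  field_simp

theorem star_lam_mul (g : G) : star (lam σ g) * lam σ g = 1 := by
  rw [star_lam, smul_mul_assoc, lam_mul, smul_smul, inv_mul_cancel, lam_one]
  simp

theorem lam_mul_star (g : G) : lam σ g * star (lam σ g) = 1 := by
  rw [star_lam, mul_smul_comm, lam_mul, smul_smul, mul_inv_cancel, lam_one]
  simp

theorem star_rho_mul (g : G) : star (rho σ g) * rho σ g = 1 := by
  rw [star_rho, smul_mul_assoc, rho_mul, smul_smul, mul_inv_cancel, rho_one]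
  simp

theorem rho_mul_star (g : G) : rho σ g * star (rho σ g) = 1 := by
  rw [star_rho, mul_smul_comm, rho_mul, smul_smul, inv_mul_cancel, rho_one]
  simp

/-- The canonical cyclic and separating vector. -/
noncomputable def delta (G : Type) [Group G] : L2 G :=
  open Classical in lp.single 2 1 1

open Classical in
theorem delta_apply (x : G) : delta G x = if x = 1 then 1 else 0 := by
  rw [delta, lp.single_apply, Pi.single_apply]

theorem lam_delta (g : G) : lam σ g (delta G) = rho σ g (delta G) := by
  ext x
  rw [rho_apply, lam_apply, delta_apply, delta_apply]
  by_cases h : x = g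
  · simp [h]
  · have h1 : g⁻¹ * x ≠ 1 := by rwa [Ne, inv_mul_eq_one, eq_comm]
    have h2 : x * g⁻¹ ≠ 1 := by rwa [Ne, mul_inv_eq_one]
    simp [h1, h2]

theorem norm_delta : ‖delta G‖ = 1 := by
  classical
  rw [delta, lp.norm_single (by norm_num)]; simp

theorem star_lam_delta (g : G) : star (lam σ g) (delta G) = star (rho σ g) (delta G) := by
  rw [star_lam, star_rho, smul_apply, smul_apply,
    lam_delta]

/-- The *-subalgebra spanned by the left regular representation. -/
noncomputable def groupAlg : StarSubalgebra ℂ (L2 G →L[ℂ] L2 G) where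
  carrier := Submodule.span ℂ (Set.range (lam σ))
  mul_mem' {a b} ha hb := by
    have h := Submodule.mul_mem_mul ha hb
    rw [Submodule.span_mul_span] at h
    refine Submodule.span_le.2 ?_ h
    rintro _ ⟨_, ⟨g, rfl⟩, _, ⟨k, rfl⟩, rfl⟩
    simp only [lam_mul]
    exact Submodule.smul_mem _ _ (Submodule.subset_span ⟨_, rfl⟩)
  add_mem' ha hb := add_mem ha hb
  algebraMap_mem' c := by
    rw [Algebra.algebraMap_eq_smul_one, ← lam_one σ]
    exact Submodule.smul_mem _ _ (Submodule.subset_span ⟨_, rfl⟩)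
  star_mem' {a} ha := by
    induction ha using Submodule.span_induction with
    | mem a h =>
      obtain ⟨g, rfl⟩ := h
      rw [star_lam]
      exact Submodule.smul_mem _ _ (Submodule.subset_span ⟨_, rfl⟩)
    | zero => rw [star_zero]; exact zero_mem _
    | add a b _ _ ha hb => rw [star_add]; exact add_mem ha hb
    | smul c a _ ha => rw [star_smul]; exact Submodule.smul_mem _ _ ha

/-- The reduced twisted group C*-algebra. -/
noncomputable def redAlg : StarSubalgebra ℂ (L2 G →L[ℂ] L2 G) :=
  (groupAlg σ).topologicalClosure

instance : IsClosed (redAlg σ : Set (L2 G →L[ℂ] L2 G)) :=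
  (groupAlg σ).isClosed_topologicalClosure

/-- The finite linear combination of left translations with coefficients `f`. -/
noncomputable def fin (f : G →₀ ℂ) : L2 G →L[ℂ] L2 G := Finsupp.linearCombination ℂ (lam σ) f

/-- The finite linear combination of right translations with coefficients `f`. -/
noncomputable def rfin (f : G →₀ ℂ) : L2 G →L[ℂ] L2 G := Finsupp.linearCombination ℂ (rho σ) f

theorem fin_apply (f : G →₀ ℂ) (ξ : L2 G) : fin σ f ξ = ∑ g ∈ f.support, f g • lam σ g ξ := by
  rw [fin, Finsupp.linearCombination_apply, Finsupp.sum, sum_apply]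
  rfl

theorem rfin_apply (f : G →₀ ℂ) (ξ : L2 G) : rfin σ f ξ = ∑ g ∈ f.support, f g • rho σ g ξ := by
  rw [rfin, Finsupp.linearCombination_apply, Finsupp.sum, sum_apply]
  rfl

theorem groupAlg_le : groupAlg σ ≤ redAlg σ := StarSubalgebra.le_topologicalClosure _

theorem lam_mem_groupAlg (g : G) : lam σ g ∈ groupAlg σ := Submodule.subset_span ⟨_, rfl⟩

theorem lam_mem (g : G) : lam σ g ∈ redAlg σ := groupAlg_le σ (lam_mem_groupAlg σ g)

theorem mem_groupAlg_iff {a : L2 G →L[ℂ] L2 G} : a ∈ groupAlg σ ↔ ∃ f, fin σ f = a :=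
  Finsupp.mem_span_range_iff_exists_finsupp

theorem fin_mem (f : G →₀ ℂ) : fin σ f ∈ redAlg σ :=
  groupAlg_le σ ((mem_groupAlg_iff σ).2 ⟨f, rfl⟩)

theorem exists_fin_near {a : L2 G →L[ℂ] L2 G} (ha : a ∈ redAlg σ) {ε : ℝ} (hε : 0 < ε) :
    ∃ f, ‖a - fin σ f‖ < ε := by
  have h : a ∈ closure (groupAlg σ : Set (L2 G →L[ℂ] L2 G)) := ha
  obtain ⟨b, hb, hab⟩ := Metric.mem_closure_iff.1 h ε hε
  obtain ⟨f, rfl⟩ := (mem_groupAlg_iff σ).1 hb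
  exact ⟨f, by rwa [← dist_eq_norm]⟩

/-- A closed linear condition satisfied by all left translations holds on the whole algebra. -/
theorem redAlg_induction {p : (L2 G →L[ℂ] L2 G) → Prop} (hcl : IsClosed {a | p a})
    (hlam : ∀ g, p (lam σ g)) (hzero : p 0) (hadd : ∀ a b, p a → p b → p (a + b))
    (hsmul : ∀ (c : ℂ) a, p a → p (c • a)) {a : L2 G →L[ℂ] L2 G} (ha : a ∈ redAlg σ) : p a := by
  have h : a ∈ closure (groupAlg σ : Set (L2 G →L[ℂ] L2 G)) := ha
  refine closure_minimal (t := {a | p a}) (fun b hb' => ?_) hcl h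
  replace hb' : b ∈ Submodule.span ℂ (Set.range (lam σ)) := hb'
  induction hb' using Submodule.span_induction with
  | mem a h => obtain ⟨g, rfl⟩ := h; exact hlam g
  | zero => exact hzero
  | add a b _ _ ha hb => exact hadd a b ha hb
  | smul c a _ ha => exact hsmul c a ha

variable {σ}

theorem comm_rho {a : L2 G →L[ℂ] L2 G} (ha : a ∈ redAlg σ) (g : G) (ξ : L2 G) :
    a (rho σ g ξ) = rho σ g (a ξ) := by
  refine redAlg_induction σ (p := fun a => a (rho σ g ξ) = rho σ g (a ξ)) ?_ ?_ ?_ ?_ ?_ ha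
  · exact isClosed_eq (by fun_prop) (by fun_prop)
  · intro k; exact lam_rho σ k g ξ
  · simp
  · intro a b ha hb; simp [ha, hb]
  · intro c a ha; simp [ha]

theorem comm_star_rho {a : L2 G →L[ℂ] L2 G} (ha : a ∈ redAlg σ) (g : G) (ξ : L2 G) :
    a (star (rho σ g) ξ) = star (rho σ g) (a ξ) := by
  simp only [star_rho, smul_apply, map_smul, comm_rho ha]

theorem rfin_apply_delta {a : L2 G →L[ℂ] L2 G} (ha : a ∈ redAlg σ) (f : G →₀ ℂ) :
    rfin σ f (a (delta G)) = a (fin σ f (delta G)) := by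
  simp only [rfin_apply, fin_apply, map_sum, map_smul, lam_delta, comm_rho ha]

/-- Elements of the algebra are determined by their value at `delta`. -/
theorem ext_delta {a b : L2 G →L[ℂ] L2 G} (ha : a ∈ redAlg σ) (hb : b ∈ redAlg σ)
    (h : a (delta G) = b (delta G)) : a = b := by
  classical
  refine lp.ext_continuousLinearMap (by norm_num) fun g => ?_
  ext1
  simp only [ContinuousLinearMap.coe_comp, Function.comp_apply,
    lp.singleContinuousLinearMap_apply]
  have hs : lp.single 2 g (1 : ℂ) = rho σ g (delta G) := by
    ext x
    rw [rho_apply, lp.single_apply, Pi.single_apply, delta_apply]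
    by_cases hx : x = g
    · simp [hx]
    · have h2 : x * g⁻¹ ≠ 1 := by rwa [Ne, mul_inv_eq_one]
      simp [hx, h2]
  rw [hs, comm_rho ha, comm_rho hb, h]

/-! ### The modular conjugation -/

variable (σ) in
/-- The modular conjugation. -/
noncomputable def modConj (ξ : L2 G) : L2 G :=
  wop (Equiv.inv G) (fun x => (σ x x : ℂ)) (fun _ => (Circle.norm_coe _).le) (star ξ)

theorem modConj_apply (ξ : L2 G) (x : G) : modConj σ ξ x = σ x x * conj (ξ x⁻¹) := rfl

theorem norm_modConj (ξ : L2 G) : ‖modConj σ ξ‖ = ‖ξ‖ := by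
  apply le_antisymm
  · refine L2.norm_le_of_apply_le (Equiv.inv G) fun x => ?_
    simp [modConj_apply, Circle.norm_coe]
  · refine L2.norm_le_of_apply_le (Equiv.inv G) fun x => ?_
    simp [modConj_apply, Circle.norm_coe]

theorem modConj_add (ξ η : L2 G) : modConj σ (ξ + η) = modConj σ ξ + modConj σ η := by
  simp [modConj]

theorem modConj_smul (c : ℂ) (ξ : L2 G) : modConj σ (c • ξ) = conj c • modConj σ ξ := by
  simp [modConj]

theorem modConj_zero : modConj σ (0 : L2 G) = 0 := by
  simp [modConj]

theorem continuous_modConj : Continuous (modConj σ) :=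
  (ContinuousLinearMap.continuous _).comp continuous_star

theorem modConj_rho (g : G) (ξ : L2 G) : modConj σ (rho σ g ξ) = star (lam σ g) (modConj σ ξ) := by
  ext x
  simp only [modConj_apply, rho_apply, star_lam, smul_apply, lam_apply,
    lp.coeFn_smul, Pi.smul_apply, smul_eq_mul, map_mul, MonoidHom.mul_apply, map_inv,
    MonoidHom.inv_apply, Circle.coe_mul, Circle.coe_inv, mul_assoc, inv_inv, mul_inv_rev, map_inv₀]
  simp only [← Circle.coe_inv_eq_conj, Circle.coe_inv, inv_inv]
  have h1 := Circle.coe_ne_zero (σ g g)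
  have h2 := Circle.coe_ne_zero (σ g x)
  field_simp

theorem modConj_delta : modConj σ (delta G) = delta G := by
  ext x
  rw [modConj_apply, delta_apply, delta_apply]
  by_cases h : x = 1 <;> simp [h]

theorem modConj_apply_delta {a : L2 G →L[ℂ] L2 G} (ha : a ∈ redAlg σ) :
    modConj σ (a (delta G)) = star a (delta G) := by
  refine redAlg_induction σ (p := fun a => modConj σ (a (delta G)) = star a (delta G))
    ?_ ?_ ?_ ?_ ?_ ha
  · refine isClosed_eq (continuous_modConj.comp (by fun_prop)) ?_
    exact (ContinuousLinearMap.apply ℂ (L2 G) (delta G)).continuous.comp continuous_star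
  · intro g
    rw [lam_delta, modConj_rho, modConj_delta]
  · simp [modConj_zero]
  · intro a b ha hb; simp [ha, hb, modConj_add]
  · intro c a ha; simp [ha, modConj_smul]

theorem modConj_sum {ι : Type*} (s : Finset ι) (f : ι → L2 G) :
    modConj σ (∑ i ∈ s, f i) = ∑ i ∈ s, modConj σ (f i) :=
  map_sum (AddMonoidHom.mk' (modConj σ) modConj_add) f s

theorem modConj_rfin (f : G →₀ ℂ) (ξ : L2 G) :
    modConj σ (rfin σ f ξ) = star (fin σ f) (modConj σ ξ) := by
  rw [rfin_apply, modConj_sum, fin, Finsupp.linearCombination_apply, Finsupp.sum, star_sum,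
    sum_apply]
  refine Finset.sum_congr rfl fun g _ => ?_
  rw [modConj_smul, modConj_rho, star_smul]
  rfl

theorem norm_rfin_le (f : G →₀ ℂ) (ξ : L2 G) : ‖rfin σ f ξ‖ ≤ ‖fin σ f‖ * ‖ξ‖ := by
  rw [← norm_modConj (σ := σ), modConj_rfin, ← norm_modConj (σ := σ) ξ, ← norm_star (fin σ f)]
  exact ContinuousLinearMap.le_opNorm _ _

theorem norm_star_delta {a : L2 G →L[ℂ] L2 G} (ha : a ∈ redAlg σ) :
    ‖star a (delta G)‖ = ‖a (delta G)‖ := by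
  rw [← modConj_apply_delta ha, norm_modConj]

theorem norm_mul_delta_le {a b : L2 G →L[ℂ] L2 G} (ha : a ∈ redAlg σ) (hb : b ∈ redAlg σ) :
    ‖(a * b) (delta G)‖ ≤ ‖a (delta G)‖ * ‖b‖ := by
  rw [← norm_star_delta (mul_mem ha hb), star_mul, ← norm_star_delta ha, mul_comm, ← norm_star b]
  exact (star b).le_opNorm _

/-! ### The trace -/

/-- The canonical trace. -/
noncomputable def tr (a : L2 G →L[ℂ] L2 G) : ℂ := a (delta G) 1

theorem tr_eq_inner (a : L2 G →L[ℂ] L2 G) : tr a = ⟪delta G, a (delta G)⟫_ℂ := by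
  classical
  rw [delta, lp.inner_single_left]
  simp [tr, delta]

theorem norm_tr_le (a : L2 G →L[ℂ] L2 G) : ‖tr a‖ ≤ ‖a‖ := by
  have h := a.le_opNorm (delta G)
  rw [norm_delta, mul_one] at h
  exact (lp.norm_apply_le_norm (by norm_num) _ _).trans h

theorem tr_add (a b : L2 G →L[ℂ] L2 G) : tr (a + b) = tr a + tr b := rfl

theorem tr_sub (a b : L2 G →L[ℂ] L2 G) : tr (a - b) = tr a - tr b := by
  simp [tr]

theorem tr_smul (c : ℂ) (a : L2 G →L[ℂ] L2 G) : tr (c • a) = c * tr a := rfl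

theorem tr_one : tr (1 : L2 G →L[ℂ] L2 G) = 1 := by simp [tr, delta_apply]

theorem tr_star_mul_self (a : L2 G →L[ℂ] L2 G) : tr (star a * a) = (‖a (delta G)‖ ^ 2 : ℝ) := by
  rw [tr_eq_inner, mul_apply_eq_comp, ContinuousLinearMap.star_eq_adjoint,
    ContinuousLinearMap.adjoint_inner_right, inner_self_eq_norm_sq_to_K]
  simp

theorem continuous_tr : Continuous (tr : (L2 G →L[ℂ] L2 G) → ℂ) :=
  AddMonoidHomClass.continuous_of_bound
    (AddMonoidHom.mk' (tr : (L2 G →L[ℂ] L2 G) → ℂ) tr_add) 1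
    fun a => by rw [one_mul]; exact norm_tr_le a

theorem tr_mul_comm {a b : L2 G →L[ℂ] L2 G} (ha : a ∈ redAlg σ) (hb : b ∈ redAlg σ) :
    tr (a * b) = tr (b * a) := by
  refine redAlg_induction σ (p := fun a => tr (a * b) = tr (b * a)) ?_ ?_ ?_ ?_ ?_ ha
  · exact isClosed_eq (continuous_tr.comp (by fun_prop)) (continuous_tr.comp (by fun_prop))
  · intro g
    simp only [tr, mul_apply_eq_comp, lam_delta]
    rw [comm_rho hb, lam_apply, rho_apply]
    simp
  · simp
  · intro a b ha hb; simp only [add_mul, mul_add, tr_add, ha, hb]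
  · intro c a ha; simp only [smul_mul_assoc, mul_smul_comm, tr_smul, ha]

end Regular

section Averaging

variable {G : Type} [Group G] {σ : G →* G →* Circle}

theorem norm_lam_apply (g : G) (ξ : L2 G) (x : G) : ‖lam σ g ξ x‖ = ‖ξ (g⁻¹ * x)‖ := by
  rw [lam_apply, norm_mul, Circle.norm_coe, one_mul]

theorem norm_star_lam_apply (g : G) (ξ : L2 G) (x : G) : ‖star (lam σ g) ξ x‖ = ‖ξ (g * x)‖ := by
  rw [star_lam, smul_apply, lp.coeFn_smul, Pi.smul_apply, norm_smul, Circle.norm_coe, one_mul,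
    norm_lam_apply, inv_inv]

theorem norm_star_rho_apply (g : G) (ξ : L2 G) (x : G) : ‖star (rho σ g) ξ x‖ = ‖ξ (x * g)‖ := by
  rw [star_rho, smul_apply, lp.coeFn_smul, Pi.smul_apply, norm_smul, Circle.norm_coe, one_mul,
    rho_apply, norm_mul, Circle.norm_coe, one_mul, inv_inv]

theorem norm_rho_apply (g : G) (ξ : L2 G) (x : G) : ‖rho σ g ξ x‖ = ‖ξ (x * g⁻¹)‖ := by
  rw [rho_apply, norm_mul, Circle.norm_coe, one_mul]

theorem norm_lam_le (g : G) (ξ : L2 G) : ‖lam σ g ξ‖ ≤ ‖ξ‖ :=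
  L2.norm_le_of_apply_le (Equiv.mulLeft g⁻¹) fun x => (norm_lam_apply g ξ x).le

theorem norm_star_lam_le (g : G) (ξ : L2 G) : ‖star (lam σ g) ξ‖ ≤ ‖ξ‖ :=
  L2.norm_le_of_apply_le (Equiv.mulLeft g) fun x => (norm_star_lam_apply g ξ x).le

theorem norm_rho_le (g : G) (ξ : L2 G) : ‖rho σ g ξ‖ ≤ ‖ξ‖ :=
  L2.norm_le_of_apply_le (Equiv.mulRight g⁻¹) fun x => (norm_rho_apply g ξ x).le

theorem norm_star_rho_le (g : G) (ξ : L2 G) : ‖star (rho σ g) ξ‖ ≤ ‖ξ‖ :=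
  L2.norm_le_of_apply_le (Equiv.mulRight g) fun x => (norm_star_rho_apply g ξ x).le

theorem opNorm_lam_le (g : G) : ‖lam σ g‖ ≤ 1 :=
  ContinuousLinearMap.opNorm_le_bound _ zero_le_one fun ξ => by
    rw [one_mul]; exact norm_lam_le g ξ

theorem norm_conj_apply (g : G) (ξ : L2 G) (x : G) :
    ‖lam σ g (star (rho σ g) ξ) x‖ = ‖ξ (g⁻¹ * x * g)‖ := by
  rw [norm_lam_apply, norm_star_rho_apply]

theorem norm_res_le_res_conj {g : G} {ξ : L2 G} {ε : ℝ}
    (h : ‖lam σ g (star (rho σ g) ξ) - ξ‖ ≤ ε) (D : Set G) :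
    ‖res D ξ‖ ≤ ‖res {x | g⁻¹ * x * g ∈ D} ξ‖ + ε := by
  have h1 : ‖res D ξ‖ ≤ ‖res {x | g⁻¹ * x * g ∈ D} (lam σ g (star (rho σ g) ξ))‖ := by
    refine L2.norm_le_of_apply_le (MulAut.conj g).toEquiv fun x => ?_
    by_cases hx : x ∈ D
    · rw [res_apply_of_mem hx, res_apply_of_mem (by simpa [mul_assoc] using hx), norm_conj_apply]
      simp [mul_assoc]
    · rw [res_apply_of_notMem hx, norm_zero]; exact norm_nonneg _
  refine h1.trans ?_
  have h2 : res {x | g⁻¹ * x * g ∈ D} (lam σ g (star (rho σ g) ξ)) =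
      res {x | g⁻¹ * x * g ∈ D} ξ +
        res {x | g⁻¹ * x * g ∈ D} (lam σ g (star (rho σ g) ξ) - ξ) := by
    rw [← map_add, add_sub_cancel]
  rw [h2]
  exact (norm_add_le _ _).trans (add_le_add le_rfl ((norm_res_le _ _).trans h))

theorem three_mul_norm_res_sq_le {g : G} {ξ : L2 G} {ε : ℝ}
    (h : ‖lam σ g (star (rho σ g) ξ) - ξ‖ ≤ ε) {D K : Set G} {ℓ : G → ℤ}
    (hK : ∀ x y : G, x ∈ K → y * x * y⁻¹ ∈ K) (hDK : D ⊆ K)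
    (hℓ : ∀ x ∈ D, ∀ i : ℕ, ℓ (g ^ i * x * (g ^ i)⁻¹) = i) :
    3 * ‖res D ξ‖ ^ 2 - 6 * ‖res D ξ‖ * ε ≤ ‖res K ξ‖ ^ 2 := by
  have hT : ∀ i : ℕ, ∀ x, (g ^ i)⁻¹ * x * g ^ i ∈ D → ℓ x = i := by
    intro i x hx
    rw [← hℓ _ hx i]
    congr 1
    group
  have hsum := sum_norm_res_sq_le (Finset.range 3) (fun i => {x | (g ^ i)⁻¹ * x * g ^ i ∈ D})
    (fun i _ j _ hij => Set.disjoint_left.2 fun x hx hx' => hij (by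
      have := (hT i x hx).symm.trans (hT j x hx')
      exact_mod_cast this)) K
    (fun i _ x hx => by
      have := hK _ (g ^ i) (hDK hx)
      simpa [mul_assoc] using this) ξ
  have h0 := norm_res_le_res_conj h D
  have h1 := norm_res_le_res_conj h {x | g⁻¹ * x * g ∈ D}
  rw [Finset.sum_range_succ, Finset.sum_range_succ, Finset.sum_range_one] at hsum
  have e0 : {x | (g ^ 0)⁻¹ * x * g ^ 0 ∈ D} = D := by ext; simp
  have e1 : {x | (g ^ 1)⁻¹ * x * g ^ 1 ∈ D} = {x | g⁻¹ * x * g ∈ D} := by simp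
  have e2 : {x | (g ^ 2)⁻¹ * x * g ^ 2 ∈ D} =
      {x | g⁻¹ * x * g ∈ {x | g⁻¹ * x * g ∈ D}} := by
    ext; simp [pow_two, mul_assoc]
  rw [e0, e1, e2] at hsum
  have hε : 0 ≤ ε := (norm_nonneg _).trans h
  generalize hp' : ‖res D ξ‖ = p at *
  have hp0 : 0 ≤ p := hp' ▸ norm_nonneg _
  generalize hq : ‖res {x | g⁻¹ * x * g ∈ D} ξ‖ = q at *
  generalize hr : ‖res {x | g⁻¹ * x * g ∈ {x | g⁻¹ * x * g ∈ D}} ξ‖ = r at *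
  have hq0 : 0 ≤ q := hq ▸ norm_nonneg _
  have hr0 : 0 ≤ r := hr ▸ norm_nonneg _
  have a1 : p ^ 2 - 2 * p * ε ≤ q ^ 2 := by
    rcases le_total p ε with hp | hp
    · nlinarith
    · nlinarith
  have a2 : p ^ 2 - 4 * p * ε ≤ r ^ 2 := by
    rcases le_total p (2 * ε) with hp | hp
    · nlinarith
    · nlinarith
  linarith

/-- Vectors almost fixed by two inner automorphisms with the paradoxical sets `D₀` and `D₁`
are almost supported off `K`. -/
theorem norm_res_le_of_almost_fixed {g₀ g₁ : G} {ξ : L2 G} {ε : ℝ}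
    (h₀ : ‖lam σ g₀ (star (rho σ g₀) ξ) - ξ‖ ≤ ε)
    (h₁ : ‖lam σ g₁ (star (rho σ g₁) ξ) - ξ‖ ≤ ε) {D₀ D₁ K : Set G} {ℓ₀ ℓ₁ : G → ℤ}
    (hK : ∀ x y : G, x ∈ K → y * x * y⁻¹ ∈ K) (hDK₀ : D₀ ⊆ K) (hDK₁ : D₁ ⊆ K)
    (hKD : K ⊆ D₀ ∪ D₁)
    (hℓ₀ : ∀ x ∈ D₀, ∀ i : ℕ, ℓ₀ (g₀ ^ i * x * (g₀ ^ i)⁻¹) = i)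
    (hℓ₁ : ∀ x ∈ D₁, ∀ i : ℕ, ℓ₁ (g₁ ^ i * x * (g₁ ^ i)⁻¹) = i) :
    ‖res K ξ‖ ≤ 12 * ε := by
  have a0 := three_mul_norm_res_sq_le h₀ hK hDK₀ hℓ₀
  have a1 := three_mul_norm_res_sq_le h₁ hK hDK₁ hℓ₁
  have a2 := norm_res_union_sq_le D₀ D₁ ξ
  rw [(Set.union_subset hDK₀ hDK₁).antisymm hKD] at a2
  have hmono : ∀ D ⊆ K, ‖res D ξ‖ ≤ ‖res K ξ‖ := by
    intro D hD
    refine L2.norm_le_of_apply_le (Equiv.refl G) fun x => ?_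
    by_cases hx : x ∈ D
    · rw [res_apply_of_mem hx, Equiv.refl_apply, res_apply_of_mem (hD hx)]
    · rw [res_apply_of_notMem hx, norm_zero]; exact norm_nonneg _
  have b0 := hmono D₀ hDK₀
  have b1 := hmono D₁ hDK₁
  have hε : 0 ≤ ε := (norm_nonneg _).trans h₀
  generalize ‖res D₀ ξ‖ = p at *
  generalize ‖res D₁ ξ‖ = q at *
  generalize ht : ‖res K ξ‖ = t at *
  have ht0 : 0 ≤ t := ht ▸ norm_nonneg _
  have c : t ^ 2 ≤ 12 * ε * t := by nlinarith
  rcases ht0.eq_or_lt with h | h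
  · rw [← h]; positivity
  · nlinarith

/-! ### Averages of inner automorphisms -/

/-- The average of the inner automorphisms implemented by a finite family. -/
noncomputable def avg {ι : Type} [Fintype ι] (g : ι → G) :
    (L2 G →L[ℂ] L2 G) →ₗ[ℂ] (L2 G →L[ℂ] L2 G) where
  toFun a := (Fintype.card ι : ℂ)⁻¹ • ∑ i, lam σ (g i) * a * star (lam σ (g i))
  map_add' a b := by simp only [mul_add, add_mul, Finset.sum_add_distrib, smul_add]
  map_smul' c a := by
    simp only [mul_smul_comm, smul_mul_assoc, ← Finset.smul_sum, RingHom.id_apply]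
    rw [smul_comm]

variable (σ) in
theorem avg_apply {ι : Type} [Fintype ι] (g : ι → G) (a : L2 G →L[ℂ] L2 G) :
    avg (σ := σ) g a = (Fintype.card ι : ℂ)⁻¹ • ∑ i, lam σ (g i) * a * star (lam σ (g i)) := rfl

theorem norm_conj_le (g : G) (a : L2 G →L[ℂ] L2 G) :
    ‖lam σ g * a * star (lam σ g)‖ ≤ ‖a‖ := by
  have h1 := norm_mul_le (lam σ g * a) (star (lam σ g))
  have h2 := norm_mul_le (lam σ g) a
  rw [norm_star (lam σ g)] at h1
  have h3 := opNorm_lam_le (σ := σ) g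
  have h4 := norm_nonneg a
  have h5 := norm_nonneg (lam σ g * a)
  nlinarith

theorem norm_avg_le {ι : Type} [Fintype ι] (g : ι → G) (a : L2 G →L[ℂ] L2 G) :
    ‖avg (σ := σ) g a‖ ≤ ‖a‖ := by
  rw [avg_apply, norm_smul, norm_inv, Complex.norm_natCast]
  have h : ‖∑ i, lam σ (g i) * a * star (lam σ (g i))‖ ≤ Fintype.card ι * ‖a‖ := by
    refine (norm_sum_le_of_le _ fun i _ => norm_conj_le (g i) a).trans ?_
    simp
  rcases isEmpty_or_nonempty ι with h1 | h1
  · simp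
  · have : (0 : ℝ) < Fintype.card ι := by exact_mod_cast Fintype.card_pos
    rw [inv_mul_le_iff₀ this]
    exact h

theorem tr_avg {ι : Type} [Fintype ι] [Nonempty ι] (g : ι → G) {a : L2 G →L[ℂ] L2 G}
    (ha : a ∈ redAlg σ) : tr (avg (σ := σ) g a) = tr a := by
  have h : ∀ i, tr (lam σ (g i) * a * star (lam σ (g i))) = tr a := fun i => by
    rw [tr_mul_comm (mul_mem (lam_mem σ _) ha) (star_mem (lam_mem σ _)), ← mul_assoc,
      star_lam_mul, one_mul]
  have h2 : tr (∑ i, lam σ (g i) * a * star (lam σ (g i))) = Fintype.card ι * tr a := by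
    rw [show tr (∑ i, lam σ (g i) * a * star (lam σ (g i))) =
      ∑ i, tr (lam σ (g i) * a * star (lam σ (g i))) from map_sum (AddMonoidHom.mk' tr tr_add) _ _]
    simp [h]
  rw [avg_apply, tr_smul, h2, inv_mul_cancel_left₀]
  exact_mod_cast Fintype.card_ne_zero

theorem avg_one {ι : Type} [Fintype ι] [Nonempty ι] (g : ι → G) :
    avg (σ := σ) g (1 : L2 G →L[ℂ] L2 G) = 1 := by
  rw [avg_apply]
  simp only [mul_one, lam_mul_star, Finset.sum_const, Finset.card_univ]
  rw [← Nat.cast_smul_eq_nsmul ℂ, smul_smul, inv_mul_cancel₀, one_smul]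
  exact_mod_cast Fintype.card_ne_zero

theorem conj_conj (g k : G) (a : L2 G →L[ℂ] L2 G) :
    lam σ g * (lam σ k * a * star (lam σ k)) * star (lam σ g) =
      lam σ (g * k) * a * star (lam σ (g * k)) := by
  have h : lam σ (g * k) = ((σ g k)⁻¹ : Circle) • (lam σ g * lam σ k) := by
    rw [lam_mul, Circle.smul_def, smul_smul, ← Circle.coe_mul, inv_mul_cancel]
    simp
  have h2 : star (((σ g k)⁻¹ : Circle) • (lam σ g * lam σ k)) =
      (σ g k) • star (lam σ g * lam σ k) := by
    rw [Circle.smul_def, Circle.smul_def, star_smul]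
    congr 1
    exact (Circle.coe_inv_eq_conj _).symm.trans (by rw [inv_inv])
  rw [h, h2, smul_mul_assoc, smul_mul_assoc, mul_smul_comm, smul_smul, inv_mul_cancel, one_smul,
    star_mul]
  simp only [mul_assoc]

theorem avg_avg {ι κ : Type} [Fintype ι] [Fintype κ] (g : ι → G) (k : κ → G)
    (a : L2 G →L[ℂ] L2 G) :
    avg (σ := σ) g (avg (σ := σ) k a) = avg (σ := σ) (fun p : ι × κ => g p.1 * k p.2) a := by
  simp only [avg_apply, mul_smul_comm, smul_mul_assoc, Finset.mul_sum, Finset.sum_mul, conj_conj,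
    Fintype.sum_prod_type, Fintype.card_prod, Nat.cast_mul, mul_inv, ← Finset.smul_sum, smul_smul]

theorem fin_mem_span {f : G →₀ ℂ} {S : Set G} (hf : ∀ g ∈ f.support, g ∈ S) :
    fin σ f ∈ Submodule.span ℂ (lam σ '' S) := by
  rw [fin, Finsupp.linearCombination_apply]
  exact Submodule.sum_mem _ fun g hg =>
    Submodule.smul_mem _ _ (Submodule.subset_span ⟨g, hf g hg, rfl⟩)

theorem exists_fin_of_mem_span {a : L2 G →L[ℂ] L2 G} {S : Set G}
    (ha : a ∈ Submodule.span ℂ (lam σ '' S)) : ∃ f : G →₀ ℂ, (∀ g ∈ f.support, g ∈ S) ∧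
      fin σ f = a := by
  obtain ⟨f, hf, rfl⟩ := (Finsupp.mem_span_image_iff_linearCombination ℂ).1 ha
  exact ⟨f, fun g hg => (Finsupp.mem_supported ℂ f).1 hf hg, rfl⟩

theorem conj_lam (g k : G) : ∃ c : Circle,
    lam σ g * lam σ k * star (lam σ g) = c • lam σ (g * k * g⁻¹) := by
  refine ⟨σ g g * σ g k * σ (g * k) g⁻¹, ?_⟩
  rw [star_lam, mul_smul_comm, lam_mul, smul_mul_assoc, lam_mul, smul_smul, smul_smul,
    Circle.smul_def, Circle.coe_mul, Circle.coe_mul]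

theorem conj_lam_of_commute {g k : G} (h : g * k = k * g) :
    lam σ g * lam σ k * star (lam σ g) = (σ g k * (σ k g)⁻¹) • lam σ k := by
  rw [star_lam, mul_smul_comm, lam_mul, smul_mul_assoc, lam_mul, smul_smul, smul_smul,
    Circle.smul_def, ← Circle.coe_mul, ← Circle.coe_mul]
  congr 1
  · rw [map_mul, MonoidHom.mul_apply, map_inv, map_inv]
    congr 1
    rw [mul_comm (σ g g), mul_assoc, mul_inv_cancel_left]
  · rw [h, mul_inv_cancel_right]

theorem avg_mem_span {ι : Type} [Fintype ι] (g : ι → G) {S : Set G}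
    (hS : ∀ x ∈ S, ∀ y, y * x * y⁻¹ ∈ S) {a : L2 G →L[ℂ] L2 G}
    (ha : a ∈ Submodule.span ℂ (lam σ '' S)) :
    avg (σ := σ) g a ∈ Submodule.span ℂ (lam σ '' S) := by
  refine Submodule.span_induction (p := fun a _ => avg (σ := σ) g a ∈ Submodule.span ℂ (lam σ '' S))
    ?_ ?_ ?_ ?_ ha
  · rintro _ ⟨k, hk, rfl⟩
    rw [avg_apply]
    refine Submodule.smul_mem _ _ (Submodule.sum_mem _ fun i _ => ?_)
    obtain ⟨c, hc⟩ := conj_lam (σ := σ) (g i) k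
    rw [hc]
    exact Submodule.smul_mem _ (c : ℂ) (Submodule.subset_span ⟨_, hS k hk _, rfl⟩)
  · simp
  · intro a b _ _ ha hb; rw [map_add]; exact add_mem ha hb
  · intro c a _ ha; rw [map_smul]; exact Submodule.smul_mem _ _ ha

theorem span_le_redAlg {S : Set G} {a : L2 G →L[ℂ] L2 G}
    (ha : a ∈ Submodule.span ℂ (lam σ '' S)) : a ∈ redAlg σ := by
  obtain ⟨f, -, rfl⟩ := exists_fin_of_mem_span ha
  exact fin_mem σ f

/-- Powers' averaging estimate. -/
theorem norm_sum_conj_le {n : ℕ} {f : G →₀ ℂ} {D : Set G} {g : Fin n → G}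
    (hf : ∀ s ∈ f.support, ∀ x ∉ D, s * x ∈ D)
    (hg : Pairwise fun i j => Disjoint {x | (g i)⁻¹ * x ∈ D} {x | (g j)⁻¹ * x ∈ D}) :
    ‖∑ i, lam σ (g i) * fin σ f * star (lam σ (g i))‖ ≤ 2 * √n * ‖fin σ f‖ := by
  set y := fin σ f with hy
  have hQyQ : ∀ ξ : L2 G, res Dᶜ (y (res Dᶜ ξ)) = 0 := by
    intro ξ
    rw [hy, fin_apply, map_sum]
    refine Finset.sum_eq_zero fun s hs => ?_
    ext x
    rw [map_smul, lp.coeFn_smul, Pi.smul_apply, lp.coeFn_zero, Pi.zero_apply]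
    by_cases hx : x ∈ D
    · rw [res_apply_of_notMem (by simpa using hx), smul_zero]
    · rw [res_apply_of_mem (by simpa using hx), lam_apply, res_apply_of_notMem, mul_zero, smul_zero]
      intro h
      exact hx (by simpa using hf s hs _ h)
  have hsplit : ∀ ξ : L2 G, ξ = res D ξ + res Dᶜ ξ := by
    intro ξ; ext x
    by_cases hx : x ∈ D <;> simp [res_apply, hx]
  have hinner : ∀ ξ η : L2 G, ‖⟪η, y ξ⟫_ℂ‖ ≤ ‖y‖ * (‖res D η‖ * ‖ξ‖ + ‖η‖ * ‖res D ξ‖) := by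
    intro ξ η
    have e1 : ⟪res Dᶜ η, y ξ⟫_ℂ = ⟪res Dᶜ η, y (res D ξ)⟫_ℂ := by
      have adj : ∀ ζ : L2 G, ⟪res Dᶜ η, ζ⟫_ℂ = ⟪η, res Dᶜ ζ⟫_ℂ := by
        intro ζ
        conv_lhs => rw [← star_res Dᶜ]
        rw [ContinuousLinearMap.star_eq_adjoint, ContinuousLinearMap.adjoint_inner_left]
      rw [adj, adj]
      conv_lhs => rw [hsplit ξ]
      rw [map_add, map_add, hQyQ, add_zero]
    have e2 : ⟪η, y ξ⟫_ℂ = ⟪res D η, y ξ⟫_ℂ + ⟪res Dᶜ η, y (res D ξ)⟫_ℂ := by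
      rw [← e1, ← inner_add_left, ← hsplit]
    rw [e2]
    refine (norm_add_le _ _).trans ?_
    have b1 := (norm_inner_le_norm (𝕜 := ℂ) (res D η) (y ξ)).trans
      (mul_le_mul_of_nonneg_left (y.le_opNorm ξ) (norm_nonneg _))
    have b2 := (norm_inner_le_norm (𝕜 := ℂ) (res Dᶜ η) (y (res D ξ))).trans
      (mul_le_mul (norm_res_le Dᶜ η) (y.le_opNorm _) (norm_nonneg _) (norm_nonneg _))
    linarith
  have hsq : ∀ ξ : L2 G, ∑ i, ‖res D (star (lam σ (g i)) ξ)‖ ≤ √n * ‖ξ‖ := by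
    intro ξ
    have h1 : ∑ i, ‖res D (star (lam σ (g i)) ξ)‖ ^ 2 ≤ ‖ξ‖ ^ 2 := by
      have h2 := sum_norm_res_sq_le Finset.univ (fun i => {x | (g i)⁻¹ * x ∈ D})
        (fun i _ j _ hij => hg hij) Set.univ (fun _ _ => Set.subset_univ _) ξ
      rw [res_univ] at h2
      refine (Finset.sum_le_sum fun i _ => ?_).trans h2
      refine pow_le_pow_left₀ (norm_nonneg _) ?_ 2
      refine L2.norm_le_of_apply_le (Equiv.mulLeft (g i)) fun x => ?_
      by_cases hx : x ∈ D
      · rw [res_apply_of_mem hx, norm_star_lam_apply, res_apply_of_mem (by simpa using hx)]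
        rfl
      · rw [res_apply_of_notMem hx, norm_zero]; exact norm_nonneg _
    have h3 := sq_sum_le_card_mul_sum_sq (s := Finset.univ)
      (f := fun i => ‖res D (star (lam σ (g i)) ξ)‖)
    rw [Finset.card_univ, Fintype.card_fin] at h3
    refine abs_le_of_sq_le_sq' ?_ (by positivity) |>.2
    rw [mul_pow, Real.sq_sqrt (by positivity)]
    exact h3.trans (mul_le_mul_of_nonneg_left h1 (by positivity))
  set T := ∑ i, lam σ (g i) * y * star (lam σ (g i)) with hT
  refine ContinuousLinearMap.opNorm_le_bound _ (by positivity) fun ξ => ?_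
  have key : ∀ η : L2 G, ‖⟪η, T ξ⟫_ℂ‖ ≤ 2 * √n * ‖y‖ * ‖ξ‖ * ‖η‖ := by
    intro η
    have e : ⟪η, T ξ⟫_ℂ = ∑ i, ⟪star (lam σ (g i)) η, y (star (lam σ (g i)) ξ)⟫_ℂ := by
      rw [hT, sum_apply, inner_sum]
      refine Finset.sum_congr rfl fun i _ => ?_
      rw [ContinuousLinearMap.star_eq_adjoint, ContinuousLinearMap.adjoint_inner_left]
      rfl
    rw [e]
    have b : ∀ i ∈ (Finset.univ : Finset (Fin n)),
        ‖⟪star (lam σ (g i)) η, y (star (lam σ (g i)) ξ)⟫_ℂ‖ ≤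
        ‖y‖ * (‖res D (star (lam σ (g i)) η)‖ * ‖ξ‖ + ‖η‖ * ‖res D (star (lam σ (g i)) ξ)‖) := by
      intro i _
      refine (hinner _ _).trans ?_
      have := norm_star_lam_le (σ := σ) (g i) ξ
      have := norm_star_lam_le (σ := σ) (g i) η
      gcongr
    refine (norm_sum_le_of_le _ b).trans ?_
    rw [← Finset.mul_sum, Finset.sum_add_distrib, ← Finset.sum_mul, ← Finset.mul_sum]
    have h1 := hsq ξ
    have h2 := hsq η
    calc _ ≤ ‖y‖ * ((√n * ‖η‖) * ‖ξ‖ + ‖η‖ * (√n * ‖ξ‖)) := by gcongr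
      _ = _ := by ring
  have h := key (T ξ)
  rw [inner_self_eq_norm_sq_to_K] at h
  simp only [Complex.coe_algebraMap, norm_pow, Complex.norm_real, norm_norm] at h
  rcases (norm_nonneg (T ξ)).eq_or_lt with h0 | h0
  · rw [← h0]; positivity
  · rw [pow_two] at h
    exact le_of_mul_le_mul_right h h0

/-- The Dixmier averaging property with respect to the canonical trace. -/
theorem exists_avg_near {H : Subgroup G} (hH : ∀ h ∈ H, ∀ g, g * h = h * g)
    (hroot : ∀ g h, (σ g h) ^ 9 = 1)
    (hχ : ∀ h ∈ H, h ≠ 1 → ∃ g, σ g h ≠ σ h g)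
    (hP : ∀ S : Finset G, (∀ s ∈ S, s ∉ H) → ∀ n : ℕ, ∃ (D : Set G) (g : Fin n → G),
      (∀ s ∈ S, ∀ x ∉ D, s * x ∈ D) ∧
      Pairwise fun i j => Disjoint {x | (g i)⁻¹ * x ∈ D} {x | (g j)⁻¹ * x ∈ D})
    {a : L2 G →L[ℂ] L2 G} (ha : a ∈ redAlg σ) {ε : ℝ} (hε : 0 < ε) :
    ∃ (ι : Type) (_ : Fintype ι) (_ : Nonempty ι) (g : ι → G),
      ‖avg (σ := σ) g a - tr a • 1‖ ≤ ε := by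
  classical
  have hoff : ∀ b ∈ Submodule.span ℂ (lam σ '' (H : Set G)ᶜ), ∀ ε > 0,
      ∃ (ι : Type) (_ : Fintype ι) (_ : Nonempty ι) (g : ι → G), ‖avg (σ := σ) g b‖ ≤ ε := by
    intro b hb ε hε
    obtain ⟨f, hf, rfl⟩ := exists_fin_of_mem_span hb
    obtain ⟨n, hn⟩ := exists_nat_gt ((2 * ‖fin σ f‖ / ε) ^ 2)
    obtain ⟨D, g, hD, hg⟩ := hP f.support (fun s hs => hf s hs) n
    have hn0 : (0 : ℝ) < n := (sq_nonneg _).trans_lt hn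
    have hn1 : 0 < n := by exact_mod_cast hn0
    refine ⟨Fin n, inferInstance, ⟨⟨0, hn1⟩⟩, g, ?_⟩
    rw [avg_apply, norm_smul, norm_inv, Fintype.card_fin, Complex.norm_natCast,
      inv_mul_le_iff₀ hn0]
    refine (norm_sum_conj_le hD hg).trans ?_
    have h1 : 2 * ‖fin σ f‖ / ε ≤ √n := Real.le_sqrt_of_sq_le hn.le
    rw [div_le_iff₀ hε] at h1
    calc 2 * √n * ‖fin σ f‖ = √n * (2 * ‖fin σ f‖) := by ring
      _ ≤ √n * (√n * ε) := by gcongr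
      _ = n * ε := by rw [← mul_assoc, Real.mul_self_sqrt hn0.le]
  have hkill : ∀ S : Finset G, (∀ s ∈ S, s ∈ H ∧ s ≠ 1) →
      ∃ (ι : Type) (_ : Fintype ι) (_ : Nonempty ι) (g : ι → G),
        ∀ k ∈ H, ∃ c : ℂ, avg (σ := σ) g (lam σ k) = c • lam σ k ∧ (k ∈ S → c = 0) := by
    intro S
    induction S using Finset.induction_on with
    | empty =>
      intro _
      refine ⟨Unit, inferInstance, inferInstance, fun _ => 1, fun k _ => ⟨1, ?_, by simp⟩⟩
      simp [avg_apply, lam_one]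
    | insert s S _ ih =>
      intro hS
      obtain ⟨ι, i1, i2, g, hg⟩ := ih fun s hs => hS s (Finset.mem_insert_of_mem hs)
      obtain ⟨x, hx⟩ := hχ s (hS s (Finset.mem_insert_self _ _)).1
        (hS s (Finset.mem_insert_self _ _)).2
      refine ⟨Fin 9 × ι, inferInstance, inferInstance, fun p => x ^ (p.1 : ℕ) * g p.2, ?_⟩
      intro k hk
      obtain ⟨c, hc, hc0⟩ := hg k hk
      have e : avg (σ := σ) (fun i : Fin 9 => x ^ (i : ℕ)) (lam σ k) =
          ((9 : ℂ)⁻¹ * ∑ i ∈ Finset.range 9, ((σ x k * (σ k x)⁻¹ : Circle) : ℂ) ^ i) • lam σ k := by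
        rw [avg_apply, Fintype.card_fin, ← Fin.sum_univ_eq_sum_range
          (fun i => ((σ x k * (σ k x)⁻¹ : Circle) : ℂ) ^ i), mul_smul, Finset.sum_smul]
        congr 1
        refine Finset.sum_congr rfl fun i _ => ?_
        rw [conj_lam_of_commute (hH k hk _), Circle.smul_def, ← Circle.coe_pow]
        congr 2
        rw [map_pow, map_pow, MonoidHom.pow_apply, mul_pow, inv_pow]
      refine ⟨c * ((9 : ℂ)⁻¹ * ∑ i ∈ Finset.range 9, ((σ x k * (σ k x)⁻¹ : Circle) : ℂ) ^ i), ?_, ?_⟩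
      · have e2 := avg_avg (σ := σ) (fun i : Fin 9 => x ^ (i : ℕ)) g (lam σ k)
        rw [← e2, hc, map_smul, e, smul_smul]
      · intro hkS
        rcases Finset.mem_insert.1 hkS with rfl | hkS
        · have h1 : ((σ x k * (σ k x)⁻¹ : Circle) : ℂ) ≠ 1 := by
            rw [Ne, Circle.coe_eq_one, mul_inv_eq_one]
            exact hx
          rw [geom_sum_eq h1, ← Circle.coe_pow, mul_pow, inv_pow, hroot, hroot]
          simp
        · rw [hc0 hkS, zero_mul]
  have hon : ∀ b ∈ Submodule.span ℂ (lam σ '' (H : Set G)),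
      ∃ (ι : Type) (_ : Fintype ι) (_ : Nonempty ι) (g : ι → G),
        avg (σ := σ) g b = tr b • (1 : L2 G →L[ℂ] L2 G) := by
    intro b hb
    obtain ⟨f, hf, rfl⟩ := exists_fin_of_mem_span hb
    obtain ⟨ι, i1, i2, g, hg⟩ := hkill (f.support.erase 1)
      fun s hs => ⟨hf s (Finset.mem_of_mem_erase hs), Finset.ne_of_mem_erase hs⟩
    refine ⟨ι, i1, i2, g, ?_⟩
    have h : ∃ c : ℂ, avg (σ := σ) g (fin σ f) = c • (1 : L2 G →L[ℂ] L2 G) := by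
      have h2 : avg (σ := σ) g (fin σ f) ∈ Submodule.span ℂ {(1 : L2 G →L[ℂ] L2 G)} := by
        rw [fin, Finsupp.linearCombination_apply, Finsupp.sum, map_sum]
        refine Submodule.sum_mem _ fun k hk => ?_
        rw [map_smul]
        refine Submodule.smul_mem _ _ ?_
        by_cases hk1 : k = 1
        · rw [hk1, lam_one, avg_one]
          exact Submodule.mem_span_singleton_self _
        · obtain ⟨c, hc, hc0⟩ := hg k (hf k hk)
          rw [hc, hc0 (Finset.mem_erase.2 ⟨hk1, hk⟩), zero_smul]
          exact zero_mem _
      obtain ⟨c, hc⟩ := Submodule.mem_span_singleton.1 h2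
      exact ⟨c, hc.symm⟩
    obtain ⟨c, hc⟩ := h
    have h2 := tr_avg g (fin_mem σ f)
    rw [hc, tr_smul, tr_one, mul_one] at h2
    rw [hc, h2]
  obtain ⟨f, hf⟩ := exists_fin_near σ ha (ε := ε / 3) (by positivity)
  have hfsplit : fin σ f = fin σ (f.filter (· ∈ H)) + fin σ (f.filter (· ∉ H)) := by
    rw [fin, fin, fin, ← map_add, Finsupp.filter_add_filter_not]
  have hm1 : fin σ (f.filter (· ∈ H)) ∈ Submodule.span ℂ (lam σ '' (H : Set G)) :=
    fin_mem_span fun g hg => (show f g ≠ 0 ∧ g ∈ H by simpa using hg).2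
  have hm2 : fin σ (f.filter (· ∉ H)) ∈ Submodule.span ℂ (lam σ '' (H : Set G)ᶜ) :=
    fin_mem_span fun g hg => (show f g ≠ 0 ∧ g ∉ H by simpa using hg).2
  obtain ⟨ι, i1, i2, g, hg⟩ := hoff _ hm2 (ε / 3) (by positivity)
  have hm3 := avg_mem_span g (fun x hx y => by
    rw [hH x hx y, mul_inv_cancel_right]; exact hx) hm1
  obtain ⟨κ, j1, j2, k, hk⟩ := hon _ hm3
  refine ⟨κ × ι, inferInstance, inferInstance, fun p => k p.1 * g p.2, ?_⟩
  rw [← avg_avg]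
  set b := fin σ f
  set b1 := fin σ (f.filter (· ∈ H))
  set b2 := fin σ (f.filter (· ∉ H))
  have e1 : avg (σ := σ) k (avg (σ := σ) g a) - tr a • 1 =
      (avg (σ := σ) k (avg (σ := σ) g (a - b)) + avg (σ := σ) k (avg (σ := σ) g b2)) +
        (tr (avg (σ := σ) g b1) - tr a) • 1 := by
    rw [sub_smul, ← hk, map_sub, map_sub, hfsplit, map_add, map_add]
    abel
  have e2 : ‖tr (avg (σ := σ) g b1) - tr a‖ ≤ ε / 3 := by
    have hb2 : tr b2 = 0 := by
      have : b2 ∈ Submodule.span ℂ (lam σ '' (H : Set G)ᶜ) := hm2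
      refine Submodule.span_induction (p := fun a _ => tr a = 0) ?_ ?_ ?_ ?_ this
      · rintro _ ⟨k, hk, rfl⟩
        rw [tr, lam_apply, delta_apply, if_neg, mul_zero]
        rintro h
        apply hk
        rw [mul_one, inv_eq_one] at h
        rw [h]; exact one_mem H
      · simp [tr]
      · intro a b _ _ ha hb; rw [tr_add, ha, hb, add_zero]
      · intro c a _ ha; rw [tr_smul, ha, mul_zero]
    rw [tr_avg g (span_le_redAlg hm1), norm_sub_rev]
    have : tr a - tr b1 = tr (a - b) := by
      rw [tr_sub, hfsplit, tr_add, hb2, add_zero]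
    rw [this]
    exact (norm_tr_le _).trans hf.le
  rw [e1]
  refine (norm_add₃_le).trans ?_
  have n1 := ((norm_avg_le (σ := σ) k (avg (σ := σ) g (a - b))).trans (norm_avg_le g _)).trans hf.le
  have n2 := (norm_avg_le (σ := σ) k (avg (σ := σ) g b2)).trans hg
  have n3 : ‖(tr (avg (σ := σ) g b1) - tr a) • (1 : L2 G →L[ℂ] L2 G)‖ ≤ ε / 3 := by
    rw [norm_smul]
    have : ‖(1 : L2 G →L[ℂ] L2 G)‖ ≤ 1 := ContinuousLinearMap.norm_id_le
    nlinarith [norm_nonneg (tr (avg (σ := σ) g b1) - tr a)]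
  linarith

end Averaging

section FreeGroup

open Monoid Monoid.CoprodI

/-- The free group on countably many generators, as a free product of copies of `ℤ`. -/
abbrev FreeGrp : Type := CoprodI fun _ : ℕ => Multiplicative ℤ

/-- Reduced words representing elements of the free group. -/
abbrev redWord : FreeGrp ≃ Word fun _ : ℕ => Multiplicative ℤ := Word.equiv

/-- The power `x_n ^ i` of the `n`-th free generator. -/
def gen (n : ℕ) (i : ℤ) : FreeGrp :=
  of (M := fun _ : ℕ => Multiplicative ℤ) (i := n) (Multiplicative.ofAdd i)

/-- The exponent of the `n`-th generator at the beginning of a reduced word. -/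
def lead (n : ℕ) (w : FreeGrp) : ℤ :=
  Multiplicative.toAdd (Word.equivPair n (redWord w)).head

theorem gen_add (n : ℕ) (i j : ℤ) : gen n (i + j) = gen n i * gen n j := by
  rw [gen, ofAdd_add, map_mul]
  rfl

theorem gen_zero (n : ℕ) : gen n 0 = 1 :=
  map_one (of (M := fun _ : ℕ => Multiplicative ℤ) (i := n))

theorem gen_neg (n : ℕ) (i : ℤ) : gen n (-i) = (gen n i)⁻¹ :=
  eq_inv_of_mul_eq_one_left (by rw [← gen_add, neg_add_cancel, gen_zero])

theorem gen_natCast (n i : ℕ) : gen n i = gen n 1 ^ i := by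
  induction i with
  | zero => rw [Nat.cast_zero, gen_zero, pow_zero]
  | succ i ih => rw [Nat.cast_succ, gen_add, ih, pow_succ]

theorem equiv_mul (g w : FreeGrp) : redWord (g * w) = g • redWord w :=
  mul_smul g w _

theorem lead_one (n : ℕ) : lead n 1 = 0 := by
  have : redWord (1 : FreeGrp) = Word.empty := one_smul FreeGrp Word.empty
  rw [lead, this, Word.equivPair_eq_of_fstIdx_ne (by simp [Word.fstIdx])]
  rfl

theorem lead_gen_mul (n : ℕ) (i : ℤ) (w : FreeGrp) : lead n (gen n i * w) = i + lead n w := by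
  rw [lead, equiv_mul, gen, Word.equivPair_smul_same]
  rfl

theorem lead_eq_zero_of_fstIdx_ne {n : ℕ} {w : FreeGrp}
    (h : (redWord w).fstIdx ≠ some n) : lead n w = 0 := by
  rw [lead, Word.equivPair_eq_of_fstIdx_ne h]
  rfl

theorem fstIdx_ne_of_lead_eq_zero {n : ℕ} {w : FreeGrp} (h : lead n w = 0) :
    (redWord w).fstIdx ≠ some n := by
  have key := Word.equivPair_head_smul_equivPair_tail (i := n) (redWord w)
  have h1 : (Word.equivPair n (redWord w)).head = 1 := Multiplicative.toAdd.injective h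
  rw [h1, map_one, one_smul] at key
  rw [← key]
  exact (Word.equivPair n (redWord w)).fstIdx_ne

theorem equiv_gen_mul {k : ℕ} {i : ℤ} {w : FreeGrp} (hi : i ≠ 0) (hw : lead k w = 0) :
    redWord (gen k i * w) = Word.cons (M := fun _ : ℕ => Multiplicative ℤ) (i := k)
      (Multiplicative.ofAdd i) (redWord w) (fstIdx_ne_of_lead_eq_zero hw)
      (fun h => hi (Multiplicative.ofAdd.injective h)) := by
  rw [equiv_mul, gen, Word.cons_eq_smul]

theorem lead_gen_mul_of_ne {j k : ℕ} (hjk : j ≠ k) {i : ℤ} {w : FreeGrp} (hi : i ≠ 0)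
    (hw : lead k w = 0) : lead j (gen k i * w) = 0 := by
  refine lead_eq_zero_of_fstIdx_ne ?_
  rw [equiv_gen_mul hi hw, Word.fstIdx_cons]
  simpa using hjk.symm

theorem reduced_induction {P : FreeGrp → Prop} (one : P 1)
    (gen_mul : ∀ k i w, i ≠ 0 → lead k w = 0 → P w → P (gen k i * w)) (w : FreeGrp) : P w := by
  suffices h : ∀ u : Word fun _ : ℕ => Multiplicative ℤ, P (redWord.symm u) by
    simpa using h (redWord w)
  intro u
  induction u using Word.consRecOn with
  | empty => exact one
  | cons k m w h1 h2 ih =>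
    have : redWord.symm (Word.cons (M := fun _ : ℕ => Multiplicative ℤ) m w h1 h2) =
        gen k (Multiplicative.toAdd m) * redWord.symm w :=
      Word.prod_cons (M := fun _ : ℕ => Multiplicative ℤ) k m w h2 h1
    rw [this]
    refine gen_mul _ _ _ (by simpa using h2) (lead_eq_zero_of_fstIdx_ne ?_) ih
    rwa [Equiv.apply_symm_apply]

theorem lead_eq_zero_of_ne {j n : ℕ} (hjn : j ≠ n) {w : FreeGrp} (hw : lead n w ≠ 0) :
    lead j w = 0 := by
  induction w using reduced_induction with
  | one => exact lead_one j
  | gen_mul k i w hi hk _ =>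
    have hkn : n = k := by
      by_contra h
      exact hw (lead_gen_mul_of_ne h hi hk)
    exact lead_gen_mul_of_ne (hkn ▸ hjn) hi hk

theorem lead_mul_gen (n : ℕ) (i : ℤ) (w : FreeGrp) :
    (∀ j, j ≠ n → lead j w = 0 → lead j (w * gen n i) = 0) ∧
      (w ≠ 1 → lead n w = 0 → lead n (w * gen n i) = 0) := by
  have base : ∀ (l : ℤ) (j : ℕ), j ≠ n → lead j (gen n l) = 0 := by
    intro l j hj
    by_cases hl : l = 0
    · rw [hl, gen_zero, lead_one]
    · rw [← mul_one (gen n l)]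
      exact lead_gen_mul_of_ne hj hl (lead_one n)
  induction w using reduced_induction with
  | one => exact ⟨fun j hj _ => by rw [one_mul]; exact base i j hj, fun h => absurd rfl h⟩
  | gen_mul k l w hl hk ih =>
    have hlk : lead k (gen k l * w) ≠ 0 := by rwa [lead_gen_mul, hk, add_zero]
    rw [mul_assoc]
    constructor
    · intro j hj h0
      have hjk : j ≠ k := by rintro rfl; exact hlk h0
      by_cases hkn : k = n
      · subst hkn
        by_cases hw : w = 1
        · rw [hw, one_mul, ← gen_add]
          exact base _ j hj
        · exact lead_gen_mul_of_ne hjk hl (ih.2 hw hk)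
      · exact lead_gen_mul_of_ne hjk hl (ih.1 k hkn hk)
    · intro _ h0
      have hkn : k ≠ n := by rintro rfl; exact hlk h0
      exact lead_gen_mul_of_ne hkn.symm hl (ih.1 k hkn hk)

theorem lead_conj {n : ℕ} {w : FreeGrp} (hw : w ≠ 1) (h0 : lead n w = 0) (i : ℤ) :
    lead n (gen n i * w * (gen n i)⁻¹) = i := by
  rw [mul_assoc, lead_gen_mul, ← gen_neg, (lead_mul_gen n (-i) w).2 hw h0, add_zero]

theorem eventually_lead_mul (f : FreeGrp) :
    ∃ N₀, ∀ N ≥ N₀, lead N f = 0 ∧ ∀ w, lead N w ≠ 0 →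
      ∀ j, lead j f = 0 → (j = N → f ≠ 1) → lead j (f * w) = 0 := by
  induction f using reduced_induction with
  | one =>
    refine ⟨0, fun N _ => ⟨lead_one N, fun w hw j _ hj => ?_⟩⟩
    rw [one_mul]
    exact lead_eq_zero_of_ne (fun h => hj h rfl) hw
  | gen_mul k l f hl hk ih =>
    obtain ⟨N₀, h⟩ := ih
    refine ⟨max N₀ (k + 1), fun N hN => ?_⟩
    have hNk : N ≠ k := by
      have := (le_max_right N₀ (k + 1)).trans hN
      omega
    refine ⟨lead_gen_mul_of_ne hNk hl hk, fun w hw j hj _ => ?_⟩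
    have hjk : j ≠ k := by
      rintro rfl
      rw [lead_gen_mul, hk, add_zero] at hj
      exact hl hj
    rw [mul_assoc]
    exact lead_gen_mul_of_ne hjk hl
      ((h N ((le_max_left _ _).trans hN)).2 w hw k hk fun h => absurd h.symm hNk)

theorem exists_lead_mul_eq_zero (S : Finset FreeGrp) (hS : ∀ f ∈ S, f ≠ 1) :
    ∃ N, ∀ f ∈ S, ∀ w, lead N w ≠ 0 → lead N (f * w) = 0 := by
  choose N₀ h using eventually_lead_mul
  refine ⟨S.sup N₀, fun f hf w hw => ?_⟩
  obtain ⟨h1, h2⟩ := h f (S.sup N₀) (Finset.le_sup hf)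
  exact h2 w hw _ h1 fun _ => hS f hf

instance : Countable FreeGrp :=
  Function.Surjective.countable (f := fun l : List (ℕ × ℤ) => (l.map fun p => gen p.1 p.2).prod)
    fun w => by
      induction w using reduced_induction with
      | one => exact ⟨[], rfl⟩
      | gen_mul k i w _ _ ih =>
        obtain ⟨l, rfl⟩ := ih
        exact ⟨(k, i) :: l, by simp⟩

end FreeGroup

section ConcreteGroup

/-- The homomorphism to `ℤ/9` sending each free generator to `1`. -/
def degHom : FreeGrp →* Multiplicative (ZMod 9) :=
  Monoid.CoprodI.lift fun _ => AddMonoidHom.toMultiplicative (Int.castAddHom (ZMod 9))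

/-- The total exponent modulo `9` of an element of the free group. -/
def deg (s : FreeGrp) : ZMod 9 := Multiplicative.toAdd (degHom s)

theorem deg_one : deg 1 = 0 := by
  rw [deg, map_one]
  rfl

theorem deg_mul (s t : FreeGrp) : deg (s * t) = deg s + deg t := by
  rw [deg, map_mul]
  rfl

theorem deg_gen (n : ℕ) (i : ℤ) : deg (gen n i) = i := by
  rw [deg, degHom, gen, Monoid.CoprodI.lift_of]
  rfl

/-- The finitely supported sequences in `ℤ/9` whose zeroth entry is a multiple of `3`. -/
def coefs : AddSubgroup (ℕ →₀ ZMod 9) where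
  carrier := {c | 3 * c 0 = 0}
  zero_mem' := by simp
  add_mem' := by
    intro a b ha hb
    simp only [Set.mem_ofPred_eq, Finsupp.add_apply] at *
    rw [mul_add, ha, hb, add_zero]
  neg_mem' := by
    intro a ha
    simp only [Set.mem_ofPred_eq, Finsupp.neg_apply] at *
    rw [mul_neg, ha, neg_zero]

/-- The sum of all entries. -/
noncomputable def tot : (ℕ →₀ ZMod 9) →ₗ[ZMod 9] ZMod 9 :=
  Finsupp.linearCombination (ZMod 9) fun _ => 1

/-- The sum of the entries with index less than `j`. -/
noncomputable def partTot (j : ℕ) : (ℕ →₀ ZMod 9) →ₗ[ZMod 9] ZMod 9 :=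
  ∑ i ∈ Finset.range j, Finsupp.lapply i

/-- The bilinear form `∑ i > j, c i * d j`. -/
noncomputable def lowForm : (ℕ →₀ ZMod 9) →ₗ[ZMod 9] (ℕ →₀ ZMod 9) →ₗ[ZMod 9] ZMod 9 :=
  Finsupp.linearCombination (ZMod 9) partTot

theorem partTot_apply (j : ℕ) (c : ℕ →₀ ZMod 9) : partTot j c = ∑ i ∈ Finset.range j, c i := by
  simp [partTot]

theorem partTot_succ (j : ℕ) (c : ℕ →₀ ZMod 9) : partTot (j + 1) c = partTot j c + c j := by
  rw [partTot_apply, partTot_apply, Finset.sum_range_succ]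

theorem partTot_single (j i : ℕ) (a : ZMod 9) :
    partTot j (Finsupp.single i a) = if i < j then a else 0 := by
  simp [partTot_apply, Finsupp.single_apply]

theorem tot_single (i : ℕ) (a : ZMod 9) : tot (Finsupp.single i a) = a := by
  simp [tot]

theorem lowForm_single_left (j : ℕ) (a : ZMod 9) (c : ℕ →₀ ZMod 9) :
    lowForm (Finsupp.single j a) c = a * partTot j c := by
  simp [lowForm]

theorem lowForm_single_right (c : ℕ →₀ ZMod 9) (j : ℕ) (a : ZMod 9) :
    lowForm c (Finsupp.single j a) = a * (tot c - partTot (j + 1) c) := by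
  induction c using Finsupp.induction_linear with
  | zero => simp
  | add c d hc hd =>
    rw [map_add, LinearMap.add_apply, hc, hd, map_add, map_add]
    ring
  | single i b =>
    rw [lowForm_single_left, partTot_single, partTot_single, tot_single]
    by_cases h : j < i
    · rw [if_pos h, if_neg (by omega)]
      ring
    · rw [if_neg h, if_pos (by omega)]
      ring

theorem eventually_partTot (c : ℕ →₀ ZMod 9) : ∃ N, ∀ j ≥ N, partTot j c = tot c := by
  induction c using Finsupp.induction_linear with
  | zero => exact ⟨0, by simp⟩
  | add c d hc hd =>
    obtain ⟨N, hN⟩ := hc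
    obtain ⟨M, hM⟩ := hd
    refine ⟨max N M, fun j hj => ?_⟩
    rw [map_add, map_add, hN j ((le_max_left _ _).trans hj), hM j ((le_max_right _ _).trans hj)]
  | single i b =>
    refine ⟨i + 1, fun j hj => ?_⟩
    rw [partTot_single, tot_single, if_pos (by omega)]

/-- The discrete group whose twisted group algebra is considered. -/
abbrev Grp : Type := FreeGrp × Multiplicative coefs

/-- The abelian coordinate. -/
def crd (g : Grp) : ℕ →₀ ZMod 9 := (Multiplicative.toAdd g.2 : coefs)

theorem crd_mul (g h : Grp) : crd (g * h) = crd g + crd h := rfl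

theorem three_mul_crd (g : Grp) : 3 * crd g 0 = 0 := (Multiplicative.toAdd g.2).2

/-- The element of the group with given coordinates. -/
def mkGrp (s : FreeGrp) (c : ℕ →₀ ZMod 9) (hc : 3 * c 0 = 0) : Grp :=
  (s, Multiplicative.ofAdd ⟨c, hc⟩)

theorem crd_mkGrp (s : FreeGrp) (c : ℕ →₀ ZMod 9) (hc : 3 * c 0 = 0) :
    crd (mkGrp s c hc) = c := rfl

theorem crd_eq_zero_iff {g : Grp} : crd g = 0 ↔ g.2 = 1 := by
  rw [crd, ZeroMemClass.coe_eq_zero]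
  rfl

theorem deg_fst_mul (g h : Grp) : deg (g * h).1 = deg g.1 + deg h.1 := deg_mul _ _

/-- The exponent of the cocycle. -/
noncomputable def expo (g h : Grp) : ZMod 9 :=
  tot (crd g) * deg h.1 + lowForm (crd g) (crd h)

theorem expo_mul_left (g g' h : Grp) : expo (g * g') h = expo g h + expo g' h := by
  simp only [expo, crd_mul, map_add, LinearMap.add_apply]
  ring

theorem expo_mul_right (g h h' : Grp) : expo g (h * h') = expo g h + expo g h' := by
  simp only [expo, crd_mul, map_add, deg_fst_mul]
  ring

/-- The bicharacter used as a cocycle. -/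
noncomputable def cocycle : Grp →* Grp →* Circle :=
  MonoidHom.mk' (fun g => MonoidHom.mk' (fun h => ZMod.toCircle (expo g h)) fun h h' => by
    rw [expo_mul_right, AddChar.map_add_eq_mul]) fun g g' => by
    ext h
    simp [expo_mul_left, AddChar.map_add_eq_mul]

theorem cocycle_apply (g h : Grp) : cocycle g h = ZMod.toCircle (expo g h) := rfl

theorem cocycle_pow (g h : Grp) : cocycle g h ^ 9 = 1 := by
  rw [cocycle_apply, ← AddChar.map_nsmul_eq_pow, nsmul_eq_mul]
  rw [show ((9 : ℕ) : ZMod 9) = 0 from rfl, zero_mul, AddChar.map_zero_eq_one]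

/-- The antisymmetrization of the exponent. -/
noncomputable def comm (g h : Grp) : ZMod 9 := expo g h - expo h g

theorem comm_mul_left (g g' h : Grp) : comm (g * g') h = comm g h + comm g' h := by
  simp only [comm, expo_mul_left, expo_mul_right]
  ring

theorem comm_mul_right (g h h' : Grp) : comm g (h * h') = comm g h + comm g h' := by
  simp only [comm, expo_mul_left, expo_mul_right]
  ring

theorem comm_one_left (h : Grp) : comm 1 h = 0 := by
  have := comm_mul_left 1 1 h
  rwa [one_mul, left_eq_add] at this

theorem comm_one_right (h : Grp) : comm h 1 = 0 := by
  have := comm_mul_right h 1 1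
  rwa [one_mul, left_eq_add] at this

theorem comm_inv_left (g h : Grp) : comm g⁻¹ h = -comm g h := by
  rw [eq_neg_iff_add_eq_zero, ← comm_mul_left, inv_mul_cancel, comm_one_left]

theorem comm_inv_right (g h : Grp) : comm g h⁻¹ = -comm g h := by
  rw [eq_neg_iff_add_eq_zero, ← comm_mul_right, inv_mul_cancel, comm_one_right]

theorem comm_swap (g h : Grp) : comm h g = -comm g h := by
  rw [comm, comm, neg_sub]

theorem comm_self (g : Grp) : comm g g = 0 := sub_self _

theorem cocycle_mul_inv (g h : Grp) :
    cocycle g h * (cocycle h g)⁻¹ = ZMod.toCircle (comm g h) := by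
  rw [cocycle_apply, cocycle_apply, comm, ← div_eq_mul_inv, AddChar.map_sub_eq_div]

/-- The central subgroup of elements with trivial free part. -/
noncomputable def cen : Subgroup Grp := (MonoidHom.fst FreeGrp (Multiplicative coefs)).ker

theorem mem_cen {g : Grp} : g ∈ cen ↔ g.1 = 1 := Iff.rfl

theorem cen_comm (h : Grp) (hh : h ∈ cen) (g : Grp) : g * h = h * g := by
  refine Prod.ext ?_ (mul_comm _ _)
  rw [Prod.fst_mul, Prod.fst_mul, mem_cen.1 hh, one_mul, mul_one]

/-- The element `(x_n ^ i, 0)`. -/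
noncomputable def fgen (n : ℕ) (i : ℤ) : Grp := (gen n i, 1)

/-- The central element `(1, e_{j + 1})`. -/
noncomputable def cgen (j : ℕ) : Grp := mkGrp 1 (Finsupp.single (j + 1) 1) (by simp)

/-- The central element `(1, 3 e_0)`. -/
noncomputable def tgen : Grp := mkGrp 1 (Finsupp.single 0 3) (by simp; rfl)

theorem cgen_mem (j : ℕ) : cgen j ∈ cen := rfl

theorem tgen_mem : tgen ∈ cen := rfl

theorem crd_fgen (n : ℕ) (i : ℤ) : crd (fgen n i) = 0 := rfl

theorem comm_fgen {h : Grp} (hh : h ∈ cen) (n : ℕ) (i : ℤ) :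
    comm h (fgen n i) = tot (crd h) * i := by
  rw [comm, expo, expo, crd_fgen, mem_cen.1 hh, deg_one, fgen, deg_gen]
  simp

theorem comm_cgen (g : Grp) (j : ℕ) :
    comm g (cgen j) = tot (crd g) - deg g.1 - (partTot (j + 1) (crd g) + partTot (j + 2) (crd g)) := by
  rw [comm, expo, expo, cgen, crd_mkGrp, lowForm_single_left, lowForm_single_right, tot_single]
  change tot (crd g) * deg 1 + _ - _ = _
  rw [deg_one]
  ring

theorem comm_tgen (g : Grp) : comm g tgen = 3 * (tot (crd g) - deg g.1) := by
  rw [comm, expo, expo, tgen, crd_mkGrp, lowForm_single_left, lowForm_single_right, tot_single]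
  change tot (crd g) * deg 1 + _ - _ = _
  rw [deg_one, partTot_succ, mul_sub, mul_add, three_mul_crd, partTot_apply]
  simp
  ring

theorem exists_comm_ne_zero {h : Grp} (hh : h ∈ cen) (h1 : h ≠ 1) : ∃ g, comm g h ≠ 0 := by
  by_contra! hc
  have hc' : ∀ g, comm h g = 0 := fun g => by rw [comm_swap, hc, neg_zero]
  have htot : tot (crd h) = 0 := by
    have := hc' (fgen 0 1)
    rwa [comm_fgen hh, Int.cast_one, mul_one] at this
  have hstep : ∀ j, crd h (j + 1) + crd h (j + 2) = 0 := by
    intro j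
    have e1 := hc' (cgen j)
    have e2 := hc' (cgen (j + 1))
    rw [comm_cgen, partTot_succ (j + 1)] at e1
    rw [comm_cgen, show j + 1 + 2 = j + 1 + 1 + 1 from rfl, partTot_succ (j + 1 + 1),
      partTot_succ (j + 1)] at e2
    linear_combination e1 - e2
  have hzero : ∀ n j, crd h (j + 1) = 0 ∨ crd h (j + 1 + n) ≠ 0 := by
    intro n j
    by_cases h0 : crd h (j + 1) = 0
    · exact Or.inl h0
    · refine Or.inr ?_
      induction n with
      | zero => exact h0
      | succ n ih =>
        intro h2
        refine ih ?_
        have := hstep (j + n)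
        rw [show j + n + 1 = j + 1 + n by ring, show j + n + 2 = j + 1 + (n + 1) by ring, h2,
          add_zero] at this
        exact this
  have hpos : ∀ j, crd h (j + 1) = 0 := by
    intro j
    refine (hzero ((crd h).support.sup id + 1) j).resolve_right fun hne => ?_
    have := Finset.le_sup (f := id) (Finsupp.mem_support_iff.2 hne)
    simp only [id] at this
    omega
  have hsing : crd h = Finsupp.single 0 (crd h 0) := by
    ext j
    cases j with
    | zero => simp
    | succ j => rw [hpos, Finsupp.single_apply, if_neg (by omega)]
  have h0 : crd h = 0 := by
    rw [hsing, tot_single] at htot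
    rw [hsing, htot, Finsupp.single_zero]
  exact h1 (Prod.ext (mem_cen.1 hh) (crd_eq_zero_iff.1 h0))

instance : Countable Grp := by
  have : Countable (Multiplicative coefs) := inferInstanceAs (Countable coefs)
  infer_instance

theorem exists_paradoxical (S : Finset Grp) (hS : ∀ s ∈ S, s ∉ cen) (n : ℕ) :
    ∃ (D : Set Grp) (g : Fin n → Grp), (∀ s ∈ S, ∀ x ∉ D, s * x ∈ D) ∧
      Pairwise fun i j => Disjoint {x | (g i)⁻¹ * x ∈ D} {x | (g j)⁻¹ * x ∈ D} := by
  classical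
  obtain ⟨N, hN⟩ := exists_lead_mul_eq_zero (S.image Prod.fst) fun f hf => by
    obtain ⟨s, hs, rfl⟩ := Finset.mem_image.1 hf
    exact hS s hs
  refine ⟨{x | lead N x.1 = 0}, fun i => fgen N (i : ℕ), fun s hs x hx =>
    hN _ (Finset.mem_image_of_mem _ hs) _ hx, fun i j hij => Set.disjoint_left.2 fun x hi hj => ?_⟩
  have key : ∀ i : Fin n, lead N ((fgen N (i : ℕ))⁻¹ * x).1 = 0 → lead N x.1 = (i : ℕ) := by
    intro i h
    change lead N ((gen N (i : ℕ))⁻¹ * x.1) = 0 at h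
    rw [← gen_neg, lead_gen_mul] at h
    omega
  have := (key i hi).symm.trans (key j hj)
  exact hij (Fin.ext (by exact_mod_cast this))

theorem dixmier {a : L2 Grp →L[ℂ] L2 Grp} (ha : a ∈ redAlg cocycle) {ε : ℝ} (hε : 0 < ε) :
    ∃ (ι : Type) (_ : Fintype ι) (_ : Nonempty ι) (g : ι → Grp),
      ‖avg (σ := cocycle) g a - tr a • 1‖ ≤ ε := by
  refine exists_avg_near cen_comm cocycle_pow (fun h hh h1 => ?_) exists_paradoxical ha hε
  obtain ⟨g, hg⟩ := exists_comm_ne_zero hh h1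
  refine ⟨g, fun he => hg ?_⟩
  have := cocycle_mul_inv g h
  rw [he, mul_inv_cancel, ← AddChar.map_zero_eq_one (ZMod.toCircle (N := 9))] at this
  exact (ZMod.injective_toCircle this).symm

theorem norm_res_compl_cen_le {ξ : L2 Grp} {ε : ℝ}
    (h₀ : ‖lam cocycle (fgen 0 1) (star (rho cocycle (fgen 0 1)) ξ) - ξ‖ ≤ ε)
    (h₁ : ‖lam cocycle (fgen 1 1) (star (rho cocycle (fgen 1 1)) ξ) - ξ‖ ≤ ε) :
    ‖res (cen : Set Grp)ᶜ ξ‖ ≤ 12 * ε := by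
  have key : ∀ n : ℕ, ∀ x ∈ {x : Grp | x.1 ≠ 1 ∧ lead n x.1 = 0}, ∀ i : ℕ,
      lead n (fgen n 1 ^ i * x * (fgen n 1 ^ i)⁻¹).1 = i := by
    intro n x hx i
    have e : (fgen n 1 ^ i * x * (fgen n 1 ^ i)⁻¹).1 = gen n i * x.1 * (gen n i)⁻¹ := by
      rw [gen_natCast]
      rfl
    rw [e, lead_conj hx.1 hx.2]
  refine norm_res_le_of_almost_fixed (ℓ₀ := fun x => lead 0 x.1)
    (ℓ₁ := fun x => lead 1 x.1) h₀ h₁ (fun x y hx hc => hx ?_) ?_ ?_ (fun x hx => ?_)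
    (key 0) (key 1)
  · have hc' : y * x * y⁻¹ ∈ cen := hc
    rw [mem_cen] at hc'
    exact mem_cen.2 (conj_eq_one_iff.1 hc')
  · exact fun x hx => hx.1
  · exact fun x hx => hx.1
  · by_cases h : lead 0 x.1 = 0
    · exact Or.inl ⟨hx, h⟩
    · exact Or.inr ⟨hx, lead_eq_zero_of_ne one_ne_zero h⟩

end ConcreteGroup

section Invariant

/-- The reduced twisted group C*-algebra. -/
abbrev Alg : Type := redAlg cocycle

noncomputable instance : CStarAlgebra (L2 Grp →L[ℂ] L2 Grp) where

/-- The `2`-norm associated with the canonical trace. -/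
noncomputable def nrm (a : Alg) : ℝ := ‖(a : L2 Grp →L[ℂ] L2 Grp) (delta Grp)‖

/-- The canonical trace. -/
noncomputable def trc (a : Alg) : ℂ := tr (a : L2 Grp →L[ℂ] L2 Grp)

/-- The canonical unitaries. -/
noncomputable def unt (g : Grp) : Alg := ⟨lam cocycle g, lam_mem cocycle g⟩

theorem star_unt_mul (g : Grp) : star (unt g) * unt g = 1 := Subtype.ext (star_lam_mul _ g)

theorem unt_mul_star (g : Grp) : unt g * star (unt g) = 1 := Subtype.ext (lam_mul_star _ g)

theorem trc_add (a b : Alg) : trc (a + b) = trc a + trc b := tr_add _ _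

theorem trc_sub (a b : Alg) : trc (a - b) = trc a - trc b := tr_sub _ _

theorem trc_smul (c : ℂ) (a : Alg) : trc (c • a) = c * trc a := tr_smul _ _

theorem trc_one : trc 1 = 1 := tr_one

theorem trc_mul_comm (a b : Alg) : trc (a * b) = trc (b * a) := tr_mul_comm a.2 b.2

theorem norm_trc_le (a : Alg) : ‖trc a‖ ≤ ‖a‖ := norm_tr_le _

theorem trc_star_mul_self (a : Alg) : trc (star a * a) = ((nrm a ^ 2 : ℝ) : ℂ) :=
  tr_star_mul_self _

theorem nrm_nonneg (a : Alg) : 0 ≤ nrm a := norm_nonneg _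

theorem eq_zero_of_nrm_eq_zero {a : Alg} (h : nrm a = 0) : a = 0 := by
  refine Subtype.ext (ext_delta a.2 (0 : Alg).2 ?_)
  exact norm_eq_zero.1 h

/-- The trace is approximated by averages of inner automorphisms. -/
theorem exists_average_near_trc (a : Alg) {ε : ℝ} (hε : 0 < ε) :
    ∃ (ι : Type) (_ : Fintype ι) (_ : Nonempty ι) (u : ι → Alg), (∀ i, star (u i) * u i = 1) ∧
      ‖((Fintype.card ι : ℂ)⁻¹ • ∑ i, u i * a * star (u i)) - trc a • 1‖ ≤ ε := by
  obtain ⟨ι, i1, i2, g, hg⟩ := dixmier a.2 hε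
  refine ⟨ι, i1, i2, fun i => unt (g i), fun i => star_unt_mul _, ?_⟩
  have key : (((Fintype.card ι : ℂ)⁻¹ • ∑ i, unt (g i) * a * star (unt (g i)) - trc a • 1 : Alg) :
      L2 Grp →L[ℂ] L2 Grp) = avg (σ := cocycle) g a - trc a • 1 := by
    have hsum : ((∑ i, unt (g i) * a * star (unt (g i)) : Alg) : L2 Grp →L[ℂ] L2 Grp) =
        ∑ i, lam cocycle (g i) * a * star (lam cocycle (g i)) :=
      map_sum (redAlg cocycle).subtype _ _
    rw [avg_apply, ← hsum]
    rfl
  exact (congrArg norm key).trans_le hg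

theorem twoSidedIdeal_eq (I : TwoSidedIdeal Alg) (hI : IsClosed (I : Set Alg)) :
    I = ⊥ ∨ I = ⊤ := by
  by_cases h : ∃ a ∈ I, a ≠ 0
  · right
    obtain ⟨a, ha, h0⟩ := h
    have hb : star a * a ∈ I := I.mul_mem_left _ _ ha
    have hsmul : ∀ (c : ℂ) (x : Alg), x ∈ I → c • x ∈ I := by
      intro c x hx
      have := I.mul_mem_left (c • 1) x hx
      rwa [smul_mul_assoc, one_mul] at this
    have h1 : trc (star a * a) • (1 : Alg) ∈ (I : Set Alg) := by
      rw [← hI.closure_eq, Metric.mem_closure_iff]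
      intro ε hε
      obtain ⟨ι, _, _, u, -, hu⟩ := exists_average_near_trc (star a * a) (half_pos hε)
      refine ⟨(Fintype.card ι : ℂ)⁻¹ • ∑ i, u i * (star a * a) * star (u i), hsmul _ _
        (sum_mem fun i _ => I.mul_mem_right _ _ (I.mul_mem_left _ _ hb)), ?_⟩
      rw [dist_comm, dist_eq_norm]
      exact hu.trans_lt (half_lt_self hε)
    have hne : trc (star a * a) ≠ 0 := by
      rw [trc_star_mul_self]
      exact_mod_cast pow_ne_zero 2 fun h => h0 (eq_zero_of_nrm_eq_zero h)
    have h2 := hsmul (trc (star a * a))⁻¹ _ h1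
    rw [smul_smul, inv_mul_cancel₀ hne, one_smul] at h2
    refine TwoSidedIdeal.ext fun x => ⟨fun _ => trivial, fun _ => ?_⟩
    simpa using I.mul_mem_left x 1 h2
  · left
    push Not at h
    refine TwoSidedIdeal.ext fun x => ⟨fun hx => ?_, fun hx => ?_⟩
    · rw [h x hx]; exact TwoSidedIdeal.zero_mem _
    · rw [TwoSidedIdeal.mem_bot] at hx
      rw [hx]; exact TwoSidedIdeal.zero_mem _

theorem separableSpace_alg : TopologicalSpace.SeparableSpace Alg := by
  have h1 : TopologicalSpace.IsSeparable
      (Submodule.span ℂ (Set.range (lam cocycle)) : Set (L2 Grp →L[ℂ] L2 Grp)) :=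
    (Set.countable_range _).isSeparable.span
  have h2 : TopologicalSpace.IsSeparable (redAlg cocycle : Set (L2 Grp →L[ℂ] L2 Grp)) :=
    h1.closure
  exact h2.separableSpace

/-- A sequence of unitaries which converges in the point-norm topology when acting by inner
automorphisms, is asymptotically central in the `2`-norm along central sequences, and
asymptotically commutes with itself up to the factor `q`. -/
structure AsympSeq (q : ℂ) (w : ℕ → Alg) : Prop where
  star_mul : ∀ m, star (w m) * w m = 1
  mul_star : ∀ m, w m * star (w m) = 1
  cauchy : ∀ a : Alg, ∀ ε > 0, ∃ N, ∀ m ≥ N, ∀ n ≥ N,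
    ‖w m * a * star (w m) - w n * a * star (w n)‖ ≤ ε
  central : ∀ ε > 0, ∃ (E : Finset Alg) (d : ℝ), 0 < d ∧
    ∀ z : Alg, star z * z = 1 → z * star z = 1 → (∀ e ∈ E, nrm (z * e - e * z) < d) →
      ∃ M, ∀ m ≥ M, nrm (w m * z - z * w m) ≤ ε
  comm : ∀ ε > 0, ∃ N, ∀ n ≥ N, ∃ M, ∀ m ≥ M, nrm (w m * w n - q • (w n * w m)) ≤ ε

section ConjugateLinear

variable {φ : Alg → Alg} (hbij : Function.Bijective φ) (hadd : ∀ x y, φ (x + y) = φ x + φ y)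
  (hmul : ∀ x y, φ (x * y) = φ x * φ y) (hstar : ∀ x, φ (star x) = star (φ x))
  (hsmul : ∀ (c : ℂ) x, φ (c • x) = conj c • φ x)

include hmul in
include hbij in
theorem map_one_alg : φ 1 = 1 := by
  obtain ⟨e, he⟩ := hbij.2 1
  calc φ 1 = φ 1 * φ e := by rw [he, mul_one]
    _ = 1 := by rw [← hmul, one_mul, he]

include hadd hmul hstar hsmul

theorem norm_map_le (x : Alg) : ‖φ x‖ ≤ ‖x‖ := by
  have h0 : φ 0 = 0 := by simpa using hadd 0 0
  let ψ : Alg →⋆ₙₐ[ℂ] Algᵐᵒᵖ :=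
    { toFun := fun x => MulOpposite.op (star (φ x))
      map_smul' := fun c x => by simp [hsmul]
      map_zero' := by simp [h0]
      map_add' := fun x y => by simp [hadd]
      map_mul' := fun x y => by simp [hmul]
      map_star' := fun x => by simp [hstar] }
  have := NonUnitalStarAlgHom.norm_apply_le ψ x
  rwa [show ‖ψ x‖ = ‖star (φ x)‖ from rfl, norm_star] at this

include hbij

theorem trc_map (a : Alg) : trc (φ a) = conj (trc a) := by
  have h0 : φ 0 = 0 := by simpa using hadd 0 0
  have h1 := map_one_alg hbij hmul
  have hneg : ∀ x, φ (-x) = -φ x := fun x => by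
    have := hadd (-x) x
    rw [neg_add_cancel, h0] at this
    exact eq_neg_of_add_eq_zero_left this.symm
  rw [← sub_eq_zero, ← norm_eq_zero]
  refine le_antisymm (le_of_forall_pos_le_add fun ε hε => ?_) (norm_nonneg _)
  obtain ⟨ι, _, _, u, hu, hle⟩ := exists_average_near_trc a hε
  have hsum : ∀ f : ι → Alg, φ (∑ i, f i) = ∑ i, φ (f i) := fun f =>
    map_sum ({ toFun := φ, map_zero' := h0, map_add' := hadd } : Alg →+ Alg) f _
  have key := (norm_map_le hadd hmul hstar hsmul _).trans hle
  have key2 := (norm_trc_le _).trans key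
  rw [sub_eq_add_neg, hadd, hneg, hsmul, hsmul, hsum, h1, ← sub_eq_add_neg, trc_sub, trc_smul,
    trc_smul, trc_one, mul_one] at key2
  have hs : trc (∑ i, φ (u i * a * star (u i))) = Fintype.card ι * trc (φ a) := by
    have hsum' : trc (∑ i, φ (u i * a * star (u i))) = ∑ i, trc (φ (u i * a * star (u i))) :=
      map_sum ({ toFun := trc, map_zero' := by simpa using trc_smul 0 0, map_add' := trc_add } :
        Alg →+ ℂ) _ _
    rw [hsum', Finset.sum_congr rfl fun i _ => ?_, Finset.sum_const, Finset.card_univ,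
      nsmul_eq_mul]
    rw [mul_assoc, hmul, hmul, trc_mul_comm, mul_assoc, ← hmul, hu, h1, mul_one]
  rw [hs, map_inv₀, Complex.conj_natCast, inv_mul_cancel_left₀] at key2
  · simpa using key2
  · exact_mod_cast Fintype.card_ne_zero

theorem nrm_map (a : Alg) : nrm (φ a) = nrm a := by
  have h := trc_star_mul_self (φ a)
  rw [← hstar, ← hmul, trc_map hbij hadd hmul hstar hsmul, trc_star_mul_self,
    Complex.conj_ofReal] at h
  have h' : nrm (φ a) ^ 2 = nrm a ^ 2 := by exact_mod_cast h.symm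
  exact (pow_left_inj₀ (nrm_nonneg _) (nrm_nonneg _) two_ne_zero).1 h'

theorem AsympSeq.map {q : ℂ} {w : ℕ → Alg} (h : AsympSeq q w) :
    AsympSeq (conj q) fun m => φ (w m) := by
  have h0 : φ 0 = 0 := by simpa using hadd 0 0
  have h1 := map_one_alg hbij hmul
  have hsub : ∀ x y, φ (x - y) = φ x - φ y := fun x y => by
    have := hadd (x - y) y
    rw [sub_add_cancel] at this
    exact eq_sub_of_add_eq this.symm
  have hn := nrm_map hbij hadd hmul hstar hsmul
  refine ⟨fun m => ?_, fun m => ?_, fun a ε hε => ?_, fun ε hε => ?_, fun ε hε => ?_⟩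
  · rw [← hstar, ← hmul, h.star_mul, h1]
  · rw [← hstar, ← hmul, h.mul_star, h1]
  · obtain ⟨b, rfl⟩ := hbij.2 a
    obtain ⟨N, hN⟩ := h.cauchy b ε hε
    refine ⟨N, fun m hm n hn => ?_⟩
    simp only [← hstar, ← hmul, ← hsub]
    exact (norm_map_le hadd hmul hstar hsmul _).trans (hN m hm n hn)
  · obtain ⟨E, d, hd, hE⟩ := h.central ε hε
    classical
    refine ⟨E.image φ, d, hd, fun z hz1 hz2 hz => ?_⟩
    obtain ⟨y, rfl⟩ := hbij.2 z
    rw [← hstar, ← hmul, ← h1] at hz1 hz2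
    obtain ⟨M, hM⟩ := hE y (hbij.1 hz1) (hbij.1 hz2) fun e he => by
      have := hz (φ e) (Finset.mem_image_of_mem _ he)
      rwa [← hmul, ← hmul, ← hsub, hn] at this
    refine ⟨M, fun m hm => ?_⟩
    rw [← hmul, ← hmul, ← hsub, hn]
    exact hM m hm
  · obtain ⟨N, hN⟩ := h.comm ε hε
    refine ⟨N, fun n hnN => ?_⟩
    obtain ⟨M, hM⟩ := hN n hnN
    refine ⟨M, fun m hm => ?_⟩
    rw [← hmul, ← hmul, ← hsmul, ← hsub, hn]
    exact hM m hm

end ConjugateLinear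

end Invariant

section Existence

theorem norm_conj_sub_le {G : Type} [Group G] {σ : G →* G →* Circle} {z : L2 G →L[ℂ] L2 G}
    (hz : z ∈ redAlg σ) (g : G) :
    ‖lam σ g (star (rho σ g) (z (delta G))) - z (delta G)‖ ≤
      ‖(z * lam σ g - lam σ g * z) (delta G)‖ := by
  have h1 : lam σ g (star (rho σ g) (z (delta G))) - z (delta G) =
      -star (rho σ g) ((z * lam σ g - lam σ g * z) (delta G)) := by
    have hc : z * lam σ g - lam σ g * z ∈ redAlg σ :=
      sub_mem (mul_mem hz (lam_mem σ g)) (mul_mem (lam_mem σ g) hz)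
    have h : lam σ g (star (lam σ g) (delta G)) = delta G := by
      rw [← mul_apply_eq_comp, lam_mul_star]
      rfl
    rw [← comm_star_rho hc, ← star_lam_delta, sub_apply, mul_apply_eq_comp, mul_apply_eq_comp, h,
      star_lam_delta, comm_star_rho hz, neg_sub]
  rw [h1, norm_neg]
  exact norm_star_rho_le _ _

theorem lam_mul_of_comm {g h : Grp} (hgh : g * h = h * g) :
    lam cocycle g * lam cocycle h =
      (ZMod.toCircle (comm g h) : ℂ) • (lam cocycle h * lam cocycle g) := by
  rw [lam_mul, lam_mul, smul_smul, ← Circle.coe_mul, ← cocycle_mul_inv, hgh, inv_mul_cancel_right]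

open Classical in
theorem res_fin_delta {G : Type} [Group G] {σ : G →* G →* Circle} (S : Set G) (f : G →₀ ℂ) :
    res S (fin σ f (delta G)) = fin σ (f.filter (· ∈ S)) (delta G) := by
  induction f using Finsupp.induction_linear with
  | zero => rw [Finsupp.filter_zero]; simp [fin]
  | add f g hf hg =>
    simp only [fin, Finsupp.filter_add, map_add, add_apply] at hf hg ⊢
    rw [hf, hg]
  | single g c =>
    ext x
    rw [res_apply]
    by_cases hg : g ∈ S
    · rw [Finsupp.filter_single_of_pos _ hg]
      by_cases hx : x ∈ S
      · rw [if_pos hx]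
      · rw [if_neg hx]
        have : g⁻¹ * x ≠ 1 := fun h => hx (by rwa [← inv_mul_eq_one.1 h])
        simp [fin, lam_apply, delta_apply, this]
    · rw [Finsupp.filter_single_of_neg _ hg]
      by_cases hx : x ∈ S
      · rw [if_pos hx]
        have : g⁻¹ * x ≠ 1 := fun h => hg (by rwa [inv_mul_eq_one.1 h])
        simp [fin, lam_apply, delta_apply, this]
      · rw [if_neg hx]
        simp [fin]

/-- The group elements defining the asymptotically central sequence. -/
noncomputable def seqElt (m : ℕ) : Grp := fgen 0 1 * cgen m

theorem eventually_comm_cgen (g : Grp) :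
    ∃ N, ∀ m ≥ N, comm (cgen m) g = tot (crd g) + deg g.1 := by
  obtain ⟨N, hN⟩ := eventually_partTot (crd g)
  refine ⟨N, fun m hm => ?_⟩
  rw [comm_swap, comm_cgen, hN _ (by omega), hN _ (by omega)]
  ring

theorem eventually_comm_seqElt {h : Grp} (hh : h ∈ cen) :
    ∃ N, ∀ m ≥ N, comm (seqElt m) h = 0 := by
  obtain ⟨N, hN⟩ := eventually_comm_cgen h
  refine ⟨N, fun m hm => ?_⟩
  rw [seqElt, comm_mul_left, hN m hm, comm_swap, comm_fgen hh, mem_cen.1 hh, deg_one]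
  push_cast
  ring

theorem comm_seqElt {m n : ℕ} (hmn : n < m) : comm (seqElt m) (seqElt n) = 1 := by
  have h : ∀ j, tot (crd (cgen j)) = 1 := fun j => tot_single _ _
  rw [seqElt, seqElt, comm_mul_left, comm_mul_right, comm_mul_right, comm_self,
    comm_swap (cgen n), comm_fgen (cgen_mem n), comm_fgen (cgen_mem m), comm_cgen, h, h,
    mem_cen.1 (cgen_mem m), deg_one, cgen, crd_mkGrp, partTot_single, partTot_single,
    if_neg (by omega), if_neg (by omega)]
  push_cast
  ring

theorem seqElt_mul_comm (m n : ℕ) : seqElt m * seqElt n = seqElt n * seqElt m :=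
  Prod.ext rfl (mul_comm _ _)

theorem eventually_conj_cgen_fin (f : Grp →₀ ℂ) :
    ∃ N, ∀ m ≥ N, ∀ n ≥ N,
      lam cocycle (cgen m) * fin cocycle f * star (lam cocycle (cgen m)) =
        lam cocycle (cgen n) * fin cocycle f * star (lam cocycle (cgen n)) := by
  induction f using Finsupp.induction_linear with
  | zero => exact ⟨0, fun m _ n _ => by simp [fin]⟩
  | add f g hf hg =>
    obtain ⟨N, hN⟩ := hf
    obtain ⟨M, hM⟩ := hg
    refine ⟨max N M, fun m hm n hn => ?_⟩
    have h : fin cocycle (f + g) = fin cocycle f + fin cocycle g := map_add _ _ _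
    rw [h, mul_add, mul_add, add_mul, add_mul,
      hN m ((le_max_left _ _).trans hm) n ((le_max_left _ _).trans hn),
      hM m ((le_max_right _ _).trans hm) n ((le_max_right _ _).trans hn)]
  | single g c =>
    obtain ⟨N, hN⟩ := eventually_comm_cgen g
    refine ⟨N, fun m hm n hn => ?_⟩
    have h : fin cocycle (Finsupp.single g c) = c • lam cocycle g := by simp [fin]
    have hc : ∀ m, cgen m * g = g * cgen m := fun m => (cen_comm _ (cgen_mem m) g).symm
    rw [h, mul_smul_comm, mul_smul_comm, smul_mul_assoc, smul_mul_assoc, conj_lam_of_commute (hc m),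
      conj_lam_of_commute (hc n), cocycle_mul_inv, cocycle_mul_inv, hN m hm, hN n hn]

theorem eventually_comm_seqElt_fin {f : Grp →₀ ℂ} (hf : ∀ g ∈ f.support, g ∈ cen) :
    ∃ N, ∀ m ≥ N, lam cocycle (seqElt m) * fin cocycle f =
      fin cocycle f * lam cocycle (seqElt m) := by
  choose! N hN using fun g hg => eventually_comm_seqElt (hf g hg)
  refine ⟨f.support.sup N, fun m hm => ?_⟩
  rw [fin, Finsupp.linearCombination_apply, Finsupp.sum, Finset.mul_sum, Finset.sum_mul]
  refine Finset.sum_congr rfl fun g hg => ?_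
  rw [mul_smul_comm, smul_mul_assoc, lam_mul_of_comm (cen_comm g (hf g hg) _),
    hN g hg m ((Finset.le_sup hg).trans hm), AddChar.map_zero_eq_one, Circle.coe_one, one_smul]

theorem asympSeq_unt :
    AsympSeq (ZMod.toCircle (1 : ZMod 9) : ℂ) fun m => unt (seqElt m) := by
  refine ⟨fun m => star_unt_mul _, fun m => unt_mul_star _, fun a ε hε => ?_, fun ε hε => ?_,
    fun ε _ => ⟨0, fun n _ => ⟨n + 1, fun m hm => ?_⟩⟩⟩
  · obtain ⟨f, hf⟩ := exists_fin_near cocycle a.2 (half_pos hε)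
    obtain ⟨N, hN⟩ := eventually_conj_cgen_fin f
    refine ⟨N, fun m hm n hn => ?_⟩
    change ‖lam cocycle (seqElt m) * (a : L2 Grp →L[ℂ] L2 Grp) * star (lam cocycle (seqElt m)) -
      lam cocycle (seqElt n) * (a : L2 Grp →L[ℂ] L2 Grp) * star (lam cocycle (seqElt n))‖ ≤ ε
    have hconj := norm_conj_le (σ := cocycle)
    generalize (a : L2 Grp →L[ℂ] L2 Grp) = a at hf ⊢
    have e : lam cocycle (seqElt m) * a * star (lam cocycle (seqElt m)) -
        lam cocycle (seqElt n) * a * star (lam cocycle (seqElt n)) =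
        lam cocycle (seqElt m) * (a - fin cocycle f) * star (lam cocycle (seqElt m)) -
          lam cocycle (seqElt n) * (a - fin cocycle f) * star (lam cocycle (seqElt n)) := by
      have h := hN m hm n hn
      have h' : lam cocycle (seqElt m) * fin cocycle f * star (lam cocycle (seqElt m)) =
          lam cocycle (seqElt n) * fin cocycle f * star (lam cocycle (seqElt n)) := by
        rw [seqElt, seqElt, ← conj_conj, ← conj_conj, h]
      simp only [mul_sub, sub_mul, h']
      abel
    rw [e]
    have := norm_sub_le (lam cocycle (seqElt m) * (a - fin cocycle f) *
      star (lam cocycle (seqElt m))) (lam cocycle (seqElt n) * (a - fin cocycle f) *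
        star (lam cocycle (seqElt n)))
    linarith [hconj (seqElt m) (a - fin cocycle f), hconj (seqElt n) (a - fin cocycle f)]
  · classical
    refine ⟨{unt (fgen 0 1), unt (fgen 1 1)}, ε / 48, by positivity, fun z _ _ hz => ?_⟩
    have hres : ∀ n ∈ ({0, 1} : Finset ℕ), ‖lam cocycle (fgen n 1) (star (rho cocycle (fgen n 1))
        ((z : L2 Grp →L[ℂ] L2 Grp) (delta Grp))) - (z : L2 Grp →L[ℂ] L2 Grp) (delta Grp)‖ ≤
          ε / 48 := by
      intro n hn
      refine (norm_conj_sub_le z.2 _).trans (hz (unt (fgen n 1)) ?_).le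
      simp only [Finset.mem_insert, Finset.mem_singleton] at hn ⊢
      rcases hn with rfl | rfl <;> simp
    have hoff := norm_res_compl_cen_le (hres 0 (by simp)) (hres 1 (by simp))
    obtain ⟨f, hf⟩ := exists_fin_near cocycle z.2 (show 0 < ε / 4 by positivity)
    obtain ⟨M, hM⟩ := eventually_comm_seqElt_fin (f := f.filter (· ∈ cen))
      fun g hg => (Finset.mem_filter.1 hg).2
    refine ⟨M, fun m hm => ?_⟩
    have hcm := hM m hm
    have hz2 := z.2
    change ‖(lam cocycle (seqElt m) * (z : L2 Grp →L[ℂ] L2 Grp) -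
      (z : L2 Grp →L[ℂ] L2 Grp) * lam cocycle (seqElt m)) (delta Grp)‖ ≤ ε
    generalize (z : L2 Grp →L[ℂ] L2 Grp) = z at hoff hf hz2 ⊢
    set b := fin cocycle (f.filter (· ∈ cen)) with hb
    have e : (lam cocycle (seqElt m) * z - z * lam cocycle (seqElt m)) (delta Grp) =
        lam cocycle (seqElt m) ((z - b) (delta Grp)) -
          rho cocycle (seqElt m) ((z - b) (delta Grp)) := by
      have hzb : z - b ∈ redAlg cocycle := sub_mem hz2 (fin_mem _ _)
      have : lam cocycle (seqElt m) * z - z * lam cocycle (seqElt m) =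
          lam cocycle (seqElt m) * (z - b) - (z - b) * lam cocycle (seqElt m) := by
        rw [mul_sub, sub_mul, hcm]
        abel
      rw [this, ← comm_rho hzb, ← lam_delta]
      rfl
    have hsplit : (z - b) (delta Grp) = res (cen : Set Grp)ᶜ (z (delta Grp)) +
        res (cen : Set Grp) ((z - fin cocycle f) (delta Grp)) := by
      rw [sub_apply, sub_apply, map_sub, res_fin_delta]
      have : z (delta Grp) = res (cen : Set Grp)ᶜ (z (delta Grp)) +
          res (cen : Set Grp) (z (delta Grp)) := by
        ext x
        by_cases hx : x ∈ (cen : Set Grp) <;> simp [res_apply, hx]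
      nth_rewrite 1 [this]
      rw [add_sub_assoc]
      rfl
    have h1 : ‖res (cen : Set Grp) ((z - fin cocycle f) (delta Grp))‖ ≤ ε / 4 := by
      refine (norm_res_le _ _).trans (((z - fin cocycle f).le_opNorm _).trans ?_)
      rw [norm_delta, mul_one]
      exact hf.le
    have h2 : ‖(z - b) (delta Grp)‖ ≤ ε / 2 := by
      rw [hsplit]
      refine (norm_add_le _ _).trans ?_
      linarith
    rw [e]
    have h3 := norm_sub_le (lam cocycle (seqElt m) ((z - b) (delta Grp)))
      (rho cocycle (seqElt m) ((z - b) (delta Grp)))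
    linarith [norm_lam_le (σ := cocycle) (seqElt m) ((z - b) (delta Grp)),
      norm_rho_le (σ := cocycle) (seqElt m) ((z - b) (delta Grp))]
  · have : unt (seqElt m) * unt (seqElt n) =
        (ZMod.toCircle (1 : ZMod 9) : ℂ) • (unt (seqElt n) * unt (seqElt m)) := by
      refine Subtype.ext ?_
      have := lam_mul_of_comm (seqElt_mul_comm m n)
      rwa [comm_seqElt (Nat.lt_of_succ_le hm)] at this
    rw [this, sub_self]
    exact (norm_zero.trans_le (le_of_lt ‹_›) : ‖(0 : L2 Grp)‖ ≤ ε)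

end Existence

section FixedVectors

/-- A monoid of contractions moving a unit vector by at most `1 / 2` has a nonzero fixed vector. -/
theorem exists_fixed_of_norm_sub_le {V : Type*} [NormedAddCommGroup V] [InnerProductSpace ℂ V]
    [CompleteSpace V] {S : Set (V →L[ℂ] V)} (h1 : 1 ∈ S) (hmul : ∀ a ∈ S, ∀ b ∈ S, a * b ∈ S)
    (hle : ∀ a ∈ S, ∀ ξ, ‖a ξ‖ ≤ ‖ξ‖) {δ : V} (hδ : ‖δ‖ = 1) (hS : ∀ a ∈ S, ‖a δ - δ‖ ≤ 1 / 2) :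
    ∃ ξ : V, ξ ≠ 0 ∧ ∀ a ∈ S, a ξ = ξ := by
  let := InnerProductSpace.rclikeToReal ℂ V
  set O : Set V := (fun a : V →L[ℂ] V => a δ) '' S with hO
  set K := closure (convexHull ℝ O) with hK
  have hKconv : Convex ℝ K := (convex_convexHull ℝ O).closure
  have hKne : K.Nonempty := ⟨δ, subset_closure (subset_convexHull ℝ O ⟨1, h1, rfl⟩)⟩
  have hball : K ⊆ Metric.closedBall δ (1 / 2) := by
    refine closure_minimal (convexHull_min ?_ (convex_closedBall _ _)) Metric.isClosed_closedBall
    rintro _ ⟨a, ha, rfl⟩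
    rw [mem_closedBall_iff_norm]
    exact hS a ha
  have hinv : ∀ a ∈ S, ∀ ξ ∈ K, a ξ ∈ K := by
    intro a ha ξ hξ
    have hmap : a '' convexHull ℝ O ⊆ convexHull ℝ O := by
      have : a '' convexHull ℝ O = convexHull ℝ (a '' O) :=
        (a.toLinearMap.restrictScalars ℝ).image_convexHull O
      rw [this]
      refine convexHull_mono ?_
      rintro _ ⟨_, ⟨b, hb, rfl⟩, rfl⟩
      exact ⟨a * b, hmul a ha b hb, rfl⟩
    exact closure_mono hmap (image_closure_subset_closure_image a.continuous ⟨ξ, hξ, rfl⟩)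
  obtain ⟨ξ, hξ, hmin⟩ := exists_norm_eq_iInf_of_complete_convex hKne isClosed_closure.isComplete
    hKconv 0
  have hmin' : ∀ η ∈ K, ‖ξ‖ ≤ ‖η‖ := by
    intro η hη
    rw [zero_sub, norm_neg] at hmin
    rw [hmin]
    have := ciInf_le (f := fun w : K => ‖(0 : V) - w‖)
      ⟨0, by rintro _ ⟨w, rfl⟩; exact norm_nonneg _⟩ ⟨η, hη⟩
    simpa using this
  refine ⟨ξ, fun h0 => ?_, fun a ha => ?_⟩
  · have := hball hξ
    rw [mem_closedBall_iff_norm, h0, zero_sub, norm_neg, hδ] at this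
    norm_num at this
  · have hmid : (2⁻¹ : ℝ) • a ξ + (2⁻¹ : ℝ) • ξ ∈ K :=
      hKconv (hinv a ha ξ hξ) hξ (by norm_num) (by norm_num) (by norm_num)
    have h2 : 2 * ‖ξ‖ ≤ ‖a ξ + ξ‖ := by
      have := hmin' _ hmid
      rw [← smul_add, norm_smul] at this
      norm_num at this
      linarith
    have hpar := parallelogram_law_with_norm ℂ (a ξ) ξ
    have h3 := hle a ha ξ
    have h4 : ‖a ξ - ξ‖ * ‖a ξ - ξ‖ ≤ 0 := by
      nlinarith [norm_nonneg ξ, norm_nonneg (a ξ), norm_nonneg (a ξ + ξ)]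
    exact sub_eq_zero.1 (norm_eq_zero.1 (mul_self_eq_zero.1 (le_antisymm h4 (mul_self_nonneg _))))

theorem comm_pow_right (g h : Grp) (n : ℕ) : comm g (h ^ n) = n * comm g h := by
  induction n with
  | zero => simp [comm_one_right]
  | succ n ih =>
    rw [pow_succ, comm_mul_right, ih]
    push_cast
    ring

theorem star_rho_mul_rho_of_comm {h : Grp} (hh : h ∈ cen) (g : Grp) :
    star (rho cocycle h) * rho cocycle g =
      (ZMod.toCircle (comm h g) : ℂ) • (rho cocycle g * star (rho cocycle h)) := by
  have h1 : rho cocycle g * rho cocycle h =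
      (ZMod.toCircle (comm h g) : ℂ) • (rho cocycle h * rho cocycle g) := by
    rw [rho_mul, rho_mul, smul_smul, ← Circle.coe_mul, ← cocycle_mul_inv, cen_comm h hh g,
      inv_mul_cancel_right]
  have h2 : star (rho cocycle h) * (rho cocycle g * rho cocycle h) * star (rho cocycle h) =
      star (rho cocycle h) * rho cocycle g := by
    rw [mul_assoc, mul_assoc, rho_mul_star, mul_one]
  rw [← h2, h1, mul_smul_comm, smul_mul_assoc, ← mul_assoc, star_rho_mul, one_mul]

/-- A fixed vector of the annihilator of finitely many group elements can be moved to a vector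
fixed by the whole central subgroup. -/
theorem exists_fixed_cen {Λ : Grp → L2 Grp →L[ℂ] L2 Grp} (h1 : Λ 1 = 1)
    (hmul : ∀ g h, Λ (g * h) = Λ g * Λ h)
    (hrho : ∀ h ∈ cen, ∀ g, Λ h * rho cocycle g =
      (ZMod.toCircle (comm h g) : ℂ) • (rho cocycle g * Λ h))
    (E : Finset Grp) (hE : ∃ ξ ≠ 0, ∀ h ∈ cen, (∀ g ∈ E, comm h g = 0) → Λ h ξ = ξ) :
    ∃ ξ ≠ 0, ∀ h ∈ cen, Λ h ξ = ξ := by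
  classical
  induction E using Finset.induction_on with
  | empty => simpa using hE
  | insert g E hg ih =>
    refine ih ?_
    obtain ⟨ξ, hξ0, hξ⟩ := hE
    set L : Set Grp := {h | h ∈ cen ∧ ∀ g ∈ E, comm h g = 0} with hL
    have hLmul : ∀ h ∈ L, ∀ k ∈ L, h * k ∈ L := fun h hh k hk =>
      ⟨mul_mem hh.1 hk.1, fun e he => by rw [comm_mul_left, hh.2 e he, hk.2 e he, add_zero]⟩
    have hLinv : ∀ h ∈ L, h⁻¹ ∈ L := fun h hh =>
      ⟨inv_mem hh.1, fun e he => by rw [comm_inv_left, hh.2 e he, neg_zero]⟩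
    have hwd : ∀ h ∈ L, ∀ k ∈ L, comm h g = comm k g → Λ h ξ = Λ k ξ := by
      intro h hh k hk he
      have hm := hLmul _ (hLinv k hk) h hh
      have : Λ (k⁻¹ * h) ξ = ξ := by
        refine hξ _ hm.1 fun e he' => ?_
        rcases Finset.mem_insert.1 he' with rfl | he'
        · rw [comm_mul_left, comm_inv_left, he, neg_add_cancel]
        · exact hm.2 e he'
      calc Λ h ξ = Λ k (Λ (k⁻¹ * h) ξ) := by
            rw [← mul_apply_eq_comp, ← hmul, mul_inv_cancel_left]
        _ = Λ k ξ := by rw [this]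
    obtain ⟨F, hF⟩ : ∃ F : ZMod 9 → L2 Grp, (∀ h ∈ L, F (comm h g) = Λ h ξ) ∧
        ∀ z, (∀ h ∈ L, comm h g ≠ z) → F z = 0 := by
      refine ⟨fun z => if h : ∃ h ∈ L, comm h g = z then Λ h.choose ξ else 0, fun h hh => ?_,
        fun z hz => dif_neg ?_⟩
      · have he : ∃ k ∈ L, comm k g = comm h g := ⟨h, hh, rfl⟩
        simp only [dif_pos he]
        exact hwd _ he.choose_spec.1 _ hh he.choose_spec.2
      · push Not
        exact hz
    have hshift : ∀ k ∈ L, ∀ z, Λ k (F z) = F (z + comm k g) := by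
      intro k hk z
      by_cases hz : ∃ h ∈ L, comm h g = z
      · obtain ⟨h, hh, rfl⟩ := hz
        rw [hF.1 h hh, add_comm, ← comm_mul_left, hF.1 _ (hLmul k hk h hh), hmul]
        rfl
      · push Not at hz
        rw [hF.2 z hz, map_zero, hF.2]
        intro h hh he
        refine hz _ (hLmul _ hh _ (hLinv k hk)) ?_
        rw [comm_mul_left, comm_inv_left, he, add_neg_cancel_right]
    have hone : (1 : Grp) ∈ L := ⟨one_mem _, fun e _ => comm_one_left e⟩
    have hF0 : F ≠ 0 := fun h0 => hξ0 <| by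
      have := hF.1 1 hone
      rw [h0, h1] at this
      exact this.symm
    obtain ⟨i, hi⟩ : ∃ i, ZMod.dft F i ≠ 0 := by
      by_contra! hz
      exact hF0 (ZMod.dft.map_eq_zero_iff.1 (funext hz))
    have heig : ∀ k ∈ L, Λ k (ZMod.dft F i) =
        (ZMod.toCircle (comm k g * i) : ℂ) • ZMod.dft F i := by
      intro k hk
      rw [ZMod.dft_apply, map_sum, Finset.smul_sum,
        ← Equiv.sum_comp (Equiv.addRight (comm k g))
          (fun z => (ZMod.toCircle (comm k g * i) : ℂ) • ZMod.stdAddChar (-(z * i)) • F z)]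
      refine Finset.sum_congr rfl fun z _ => ?_
      rw [map_smul, hshift k hk, smul_smul, Equiv.coe_addRight, ZMod.stdAddChar_apply,
        ZMod.stdAddChar_apply, ← Circle.coe_mul, ← AddChar.map_add_eq_mul]
      congr 4
      ring
    refine ⟨rho cocycle (g ^ (-i).val) (ZMod.dft F i), fun h0 => hi ?_, fun h hh he => ?_⟩
    · have := congrArg (star (rho cocycle (g ^ (-i).val)) : L2 Grp →L[ℂ] L2 Grp) h0
      rwa [← mul_apply_eq_comp, star_rho_mul, map_zero] at this
    · rw [← mul_apply_eq_comp, hrho h hh, smul_apply, mul_apply_eq_comp, heig h ⟨hh, he⟩, map_smul,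
        smul_smul, ← Circle.coe_mul, ← AddChar.map_add_eq_mul, comm_pow_right, ZMod.natCast_val,
        ZMod.cast_id]
      rw [show -i * comm h g + comm h g * i = 0 by ring, AddChar.map_zero_eq_one, Circle.coe_one,
        one_smul]

theorem norm_apply_of_star_mul_self {a : L2 Grp →L[ℂ] L2 Grp} (ha : star a * a = 1) (ξ : L2 Grp) :
    ‖a ξ‖ = ‖ξ‖ := by
  have h := ContinuousLinearMap.apply_norm_sq_eq_inner_adjoint_right a ξ
  rw [← ContinuousLinearMap.star_eq_adjoint, ← ContinuousLinearMap.mul_def, ha, one_apply_eq_self,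
    inner_self_eq_norm_sq] at h
  exact (pow_left_inj₀ (norm_nonneg _) (norm_nonneg _) two_ne_zero).1 h

theorem lam_mul_fin_of_comm {h : Grp} (hh : h ∈ cen) {f : Grp →₀ ℂ}
    (hf : ∀ g ∈ f.support, comm h g = 0) :
    lam cocycle h * fin cocycle f = fin cocycle f * lam cocycle h := by
  rw [fin, Finsupp.linearCombination_apply, Finsupp.sum, Finset.mul_sum, Finset.sum_mul]
  refine Finset.sum_congr rfl fun g hg => ?_
  rw [mul_smul_comm, smul_mul_assoc, lam_mul_of_comm (cen_comm h hh g).symm, hf g hg,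
    AddChar.map_zero_eq_one, Circle.coe_one, one_smul]

theorem norm_lam_mul_sub_le {h : Grp} (hh : h ∈ cen) {f : Grp →₀ ℂ}
    (hf : ∀ g ∈ f.support, comm h g = 0) (a : L2 Grp →L[ℂ] L2 Grp) :
    ‖(lam cocycle h * a - a * lam cocycle h) (delta Grp)‖ ≤ 2 * ‖a - fin cocycle f‖ := by
  have e : lam cocycle h * a - a * lam cocycle h =
      lam cocycle h * (a - fin cocycle f) - (a - fin cocycle f) * lam cocycle h := by
    rw [mul_sub, sub_mul, lam_mul_fin_of_comm hh hf]
    abel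
  rw [e, two_mul]
  refine (norm_sub_le _ _).trans (add_le_add ?_ ?_)
  · refine (norm_lam_le _ _).trans (((a - fin cocycle f).le_opNorm _).trans ?_)
    rw [norm_delta, mul_one]
  · refine ((a - fin cocycle f).le_opNorm _).trans ?_
    refine mul_le_of_le_one_right (norm_nonneg _) ((norm_lam_le _ _).trans ?_)
    rw [norm_delta]

/-- An asymptotically central sequence of unitaries is asymptotically invariant, in a suitable
vector state, under the central subgroup. -/
theorem exists_vector_of_asympSeq {q : ℂ} {w : ℕ → Alg} (hw : AsympSeq q w) :
    ∃ x : L2 Grp, ‖x‖ = 1 ∧ ∀ t ∈ cen, ∀ ε > 0, ∃ N, ∀ m ≥ N,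
      ‖lam cocycle t (star (rho cocycle t) (star (w m : L2 Grp →L[ℂ] L2 Grp) x)) -
        star (w m : L2 Grp →L[ℂ] L2 Grp) x‖ ≤ ε := by
  have hlim : ∀ a : Alg, ∃ b, Filter.Tendsto (fun m => w m * a * star (w m)) Filter.atTop
      (nhds b) := by
    intro a
    refine cauchySeq_tendsto_of_complete (Metric.cauchySeq_iff.2 fun ε hε => ?_)
    obtain ⟨N, hN⟩ := hw.cauchy a (ε / 2) (half_pos hε)
    refine ⟨N, fun m hm n hn => ?_⟩
    rw [dist_eq_norm]
    exact (hN m hm n hn).trans_lt (half_lt_self hε)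
  choose θ hθ using hlim
  have hθmul : ∀ a b, θ (a * b) = θ a * θ b := by
    intro a b
    refine tendsto_nhds_unique (hθ (a * b)) (((hθ a).mul (hθ b)).congr fun m => ?_)
    calc w m * a * star (w m) * (w m * b * star (w m)) =
          w m * a * (star (w m) * w m) * b * star (w m) := by simp only [mul_assoc]
      _ = w m * (a * b) * star (w m) := by rw [hw.star_mul, mul_one]; simp only [mul_assoc]
  have hθone : θ 1 = 1 := by
    refine tendsto_nhds_unique (hθ 1) (tendsto_const_nhds.congr fun m => ?_)
    rw [mul_one, hw.mul_star]
  have hθsmul : ∀ (c : ℂ) a, θ (c • a) = c • θ a := by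
    intro c a
    refine tendsto_nhds_unique (hθ (c • a)) (((hθ a).const_smul c).congr fun m => ?_)
    rw [mul_smul_comm, smul_mul_assoc]
  set Λ : Grp → L2 Grp →L[ℂ] L2 Grp := fun g =>
    (θ (unt g) : L2 Grp →L[ℂ] L2 Grp) * star (rho cocycle g) with hΛ
  have hconv : ∀ g ξ, Filter.Tendsto (fun m => ((w m * unt g * star (w m) : Alg) :
      L2 Grp →L[ℂ] L2 Grp) (star (rho cocycle g) ξ)) Filter.atTop (nhds (Λ g ξ)) := by
    intro g ξ
    have h : Filter.Tendsto (fun m => ((w m * unt g * star (w m) : Alg) : L2 Grp →L[ℂ] L2 Grp))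
        Filter.atTop (nhds (θ (unt g) : L2 Grp →L[ℂ] L2 Grp)) :=
      (continuous_subtype_val.tendsto _).comp (hθ (unt g))
    exact ((ContinuousLinearMap.apply ℂ (L2 Grp) (star (rho cocycle g) ξ)).continuous.tendsto _).comp h
  have hΛone : Λ 1 = 1 := by
    have : unt 1 = 1 := Subtype.ext (lam_one _)
    simp only [hΛ]
    rw [this, hθone, rho_one, star_one, mul_one]
    rfl
  have hcommr : ∀ (a : Alg) g, (a : L2 Grp →L[ℂ] L2 Grp) * rho cocycle g =
      rho cocycle g * (a : L2 Grp →L[ℂ] L2 Grp) := fun a g =>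
    ContinuousLinearMap.ext fun ξ => comm_rho a.2 g ξ
  have hcommsr : ∀ (a : Alg) g, (a : L2 Grp →L[ℂ] L2 Grp) * star (rho cocycle g) =
      star (rho cocycle g) * (a : L2 Grp →L[ℂ] L2 Grp) := fun a g =>
    ContinuousLinearMap.ext fun ξ => comm_star_rho a.2 g ξ
  have hΛmul : ∀ g h, Λ (g * h) = Λ g * Λ h := by
    intro g h
    have h1 : unt g * unt h = (cocycle g h : ℂ) • unt (g * h) := Subtype.ext (lam_mul _ g h)
    have h2 : (θ (unt g) : L2 Grp →L[ℂ] L2 Grp) * (θ (unt h) : L2 Grp →L[ℂ] L2 Grp) =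
        (cocycle g h : ℂ) • (θ (unt (g * h)) : L2 Grp →L[ℂ] L2 Grp) := by
      have := congrArg θ h1
      rw [hθmul, hθsmul] at this
      exact congrArg Subtype.val this
    have h3 : star (rho cocycle g) * star (rho cocycle h) =
        conj (cocycle g h : ℂ) • star (rho cocycle (g * h)) := by
      rw [← star_mul, rho_mul, star_smul]
      rfl
    simp only [hΛ]
    rw [mul_assoc, ← mul_assoc (star _), ← hcommsr, mul_assoc, ← mul_assoc, h2, h3, smul_mul_smul,
      ← Circle.coe_inv_eq_conj, ← Circle.coe_mul, mul_inv_cancel, Circle.coe_one, one_smul]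
  have hΛrho : ∀ h ∈ cen, ∀ g, Λ h * rho cocycle g =
      (ZMod.toCircle (comm h g) : ℂ) • (rho cocycle g * Λ h) := by
    intro h hh g
    simp only [hΛ]
    rw [mul_assoc, star_rho_mul_rho_of_comm hh, mul_smul_comm, ← mul_assoc, hcommr, mul_assoc]
  have hw1 : ∀ m, star (w m : L2 Grp →L[ℂ] L2 Grp) * w m = 1 := fun m =>
    congrArg Subtype.val (hw.star_mul m)
  have hw2 : ∀ m, (w m : L2 Grp →L[ℂ] L2 Grp) * star (w m : L2 Grp →L[ℂ] L2 Grp) = 1 := fun m =>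
    congrArg Subtype.val (hw.mul_star m)
  have hstar : ∀ m ξ, ‖star (w m : L2 Grp →L[ℂ] L2 Grp) ξ‖ = ‖ξ‖ := fun m ξ =>
    norm_apply_of_star_mul_self (by rw [star_star, hw2]) ξ
  have hΛle : ∀ g ξ, ‖Λ g ξ‖ ≤ ‖ξ‖ := by
    intro g ξ
    refine le_of_tendsto (hconv g ξ).norm (Filter.Eventually.of_forall fun m => ?_)
    change ‖(w m : L2 Grp →L[ℂ] L2 Grp) (lam cocycle g (star (w m : L2 Grp →L[ℂ] L2 Grp)
      (star (rho cocycle g) ξ)))‖ ≤ ‖ξ‖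
    rw [norm_apply_of_star_mul_self (hw1 m)]
    refine (norm_lam_le _ _).trans ?_
    rw [hstar]
    exact norm_star_rho_le _ _
  have hfix : ∃ ξ ≠ 0, ∀ h ∈ cen, Λ h ξ = ξ := by
    obtain ⟨E, d, hd, hE⟩ := hw.central (1 / 2) (by norm_num)
    choose f hf using fun e : Alg => exists_fin_near cocycle e.2 (half_pos hd)
    classical
    refine exists_fixed_cen hΛone hΛmul hΛrho (E.biUnion fun e => (f e).support) ?_
    set L : Set Grp := {h | h ∈ cen ∧ ∀ g ∈ E.biUnion fun e => (f e).support, comm h g = 0}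
    have hLmul : ∀ a ∈ Λ '' L, ∀ b ∈ Λ '' L, a * b ∈ Λ '' L := by
      rintro _ ⟨h, hh, rfl⟩ _ ⟨k, hk, rfl⟩
      exact ⟨h * k, ⟨mul_mem hh.1 hk.1, fun g hg => by
        rw [comm_mul_left, hh.2 g hg, hk.2 g hg, add_zero]⟩, hΛmul h k⟩
    have hLle : ∀ a ∈ Λ '' L, ∀ ξ, ‖a ξ‖ ≤ ‖ξ‖ := by
      rintro _ ⟨h, _, rfl⟩
      exact hΛle h
    have hLδ : ∀ a ∈ Λ '' L, ‖a (delta Grp) - delta Grp‖ ≤ 1 / 2 := by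
      rintro _ ⟨h, hh, rfl⟩
      obtain ⟨M, hM⟩ := hE (unt h) (star_unt_mul h) (unt_mul_star h) fun e he => by
        have := norm_lam_mul_sub_le hh.1 (f := f e)
          (fun g hg => hh.2 g (Finset.mem_biUnion.2 ⟨e, he, hg⟩)) (e : L2 Grp →L[ℂ] L2 Grp)
        exact this.trans_lt (by linarith [hf e])
      refine le_of_tendsto ((hconv h (delta Grp)).sub_const _).norm
        (Filter.eventually_atTop.2 ⟨M, fun m hm => le_trans ?_ (hM m hm)⟩)
      have h1 : (w m * unt h * star (w m) * star (unt h) - 1 : Alg) =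
          (w m * unt h - unt h * w m) * (star (w m) * star (unt h)) := by
        rw [sub_mul, mul_assoc (unt h), ← mul_assoc (w m) (star (w m)), hw.mul_star, one_mul,
          unt_mul_star]
        simp only [mul_assoc]
      have h2 : ((w m * unt h * star (w m) : Alg) : L2 Grp →L[ℂ] L2 Grp)
          (star (rho cocycle h) (delta Grp)) - delta Grp =
          ((w m * unt h * star (w m) * star (unt h) - 1 : Alg) : L2 Grp →L[ℂ] L2 Grp)
            (delta Grp) := by
        rw [← star_lam_delta]
        rfl
      rw [h2, h1]
      refine (norm_mul_delta_le (Subtype.prop _) (Subtype.prop _)).trans ?_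
      refine mul_le_of_le_one_right (norm_nonneg _)
        (ContinuousLinearMap.opNorm_le_bound _ zero_le_one fun ξ => ?_)
      change ‖star (w m : L2 Grp →L[ℂ] L2 Grp) (star (lam cocycle h) ξ)‖ ≤ _
      rw [hstar, one_mul]
      exact norm_star_lam_le _ _
    obtain ⟨ξ, h0, hξ⟩ := exists_fixed_of_norm_sub_le (S := Λ '' L)
      ⟨1, ⟨one_mem _, fun g _ => comm_one_left g⟩, hΛone⟩ hLmul hLle norm_delta hLδ
    exact ⟨ξ, h0, fun h hh he => hξ _ ⟨h, ⟨hh, he⟩, rfl⟩⟩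
  obtain ⟨ξ, h0, hξ⟩ := hfix
  have hn : (‖ξ‖ : ℂ) ≠ 0 := by exact_mod_cast norm_ne_zero_iff.2 h0
  refine ⟨(‖ξ‖ : ℂ)⁻¹ • ξ, ?_, fun t ht ε hε => ?_⟩
  · rw [norm_smul, norm_inv, Complex.norm_real, norm_norm, inv_mul_cancel₀ (norm_ne_zero_iff.2 h0)]
  · set x := (‖ξ‖ : ℂ)⁻¹ • ξ
    have hx : Λ t x = x := by rw [map_smul, hξ t ht]
    have hc := hconv t x
    rw [hx, Metric.tendsto_atTop] at hc
    obtain ⟨N, hN⟩ := hc ε hε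
    refine ⟨N, fun m hm => ?_⟩
    have := (hN m hm).le
    rw [dist_eq_norm, ← hstar m, map_sub] at this
    refine le_trans (le_of_eq ?_) this
    change _ = ‖star (w m : L2 Grp →L[ℂ] L2 Grp) ((w m : L2 Grp →L[ℂ] L2 Grp)
      (lam cocycle t (star (w m : L2 Grp →L[ℂ] L2 Grp) (star (rho cocycle t) x)))) - _‖
    rw [comm_star_rho (star_mem (w m).2), ← mul_apply_eq_comp (star _) (w m : L2 Grp →L[ℂ] L2 Grp),
      hw1, one_apply_eq_self]

end FixedVectors

section Rigidity

/-- The pointwise absolute value of a square-summable function. -/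
noncomputable def L2.abs {G : Type} (ξ : L2 G) : L2 G :=
  ⟨fun x => (‖ξ x‖ : ℂ), L2.memℓp_two (by simpa using L2.summable_norm_sq ξ)⟩

theorem L2.abs_apply {G : Type} (ξ : L2 G) (x : G) : L2.abs ξ x = (‖ξ x‖ : ℂ) := rfl

theorem L2.norm_abs {G : Type} (ξ : L2 G) : ‖L2.abs ξ‖ = ‖ξ‖ :=
  le_antisymm (L2.norm_le_of_apply_le (Equiv.refl G) fun x => by simp [L2.abs_apply])
    (L2.norm_le_of_apply_le (Equiv.refl G) fun x => by simp [L2.abs_apply])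

theorem L2.norm_le_sum {G ι : Type} (s : Finset ι) {ξ : L2 G} {γ : ι → L2 G}
    (h : ∀ x, ‖ξ x‖ ≤ ∑ i ∈ s, ‖γ i x‖) : ‖ξ‖ ≤ ∑ i ∈ s, ‖γ i‖ := by
  calc ‖ξ‖ ≤ ‖∑ i ∈ s, L2.abs (γ i)‖ := by
        refine L2.norm_le_of_apply_le (Equiv.refl G) fun x => (h x).trans ?_
        have : (∑ i ∈ s, L2.abs (γ i)) x = ((∑ i ∈ s, ‖γ i x‖ : ℝ) : ℂ) := by
          rw [lp.coeFn_sum, Finset.sum_apply]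
          push_cast
          rfl
        rw [Equiv.refl_apply, this, Complex.norm_real]
        exact le_abs_self _
    _ ≤ ∑ i ∈ s, ‖L2.abs (γ i)‖ := norm_sum_le _ _
    _ = ∑ i ∈ s, ‖γ i‖ := Finset.sum_congr rfl fun i _ => L2.norm_abs _

theorem fin_single {G : Type} [Group G] (σ : G →* G →* Circle) (g : G) (c : ℂ) :
    fin σ (Finsupp.single g c) = c • lam σ g := by
  simp [fin]

theorem lp_single_eq (g : Grp) (c : ℂ) :
    (lp.single 2 g c : L2 Grp) = fin cocycle (Finsupp.single g c) (delta Grp) := by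
  ext x
  rw [fin_single, smul_apply, lp.coeFn_smul, Pi.smul_apply, lam_apply, delta_apply,
    lp.coeFn_single]
  by_cases hx : x = g
  · subst hx
    simp
  · have : ¬ g⁻¹ * x = 1 := fun h => hx (inv_mul_eq_one.1 h).symm
    simp [hx, this]

theorem exists_fin_delta_near (x : L2 Grp) {ε : ℝ} (hε : 0 < ε) :
    ∃ f : Grp →₀ ℂ, ‖fin cocycle f (delta Grp) - x‖ ≤ ε := by
  classical
  have h := lp.hasSum_single (E := fun _ : Grp => ℂ) (p := 2) (by norm_num) x
  obtain ⟨s, hs⟩ := (Metric.tendsto_atTop.1 h) ε hε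
  refine ⟨∑ g ∈ s, Finsupp.single g (x g), ?_⟩
  have := (hs s le_rfl).le
  rw [dist_eq_norm] at this
  have hsum : fin cocycle (∑ g ∈ s, Finsupp.single g (x g)) =
      ∑ g ∈ s, fin cocycle (Finsupp.single g (x g)) :=
    map_sum (Finsupp.linearCombination ℂ (lam cocycle)) _ _
  have e : fin cocycle (∑ g ∈ s, Finsupp.single g (x g)) (delta Grp) =
      ∑ g ∈ s, (lp.single 2 g (x g) : L2 Grp) := by
    rw [hsum, sum_apply]
    exact Finset.sum_congr rfl fun g _ => (lp_single_eq g _).symm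
  rw [e]
  exact this

theorem conj_cen_apply {t : Grp} (ht : t ∈ cen) (ξ : L2 Grp) (x : Grp) :
    lam cocycle t (star (rho cocycle t) ξ) x = ZMod.toCircle (comm t x) * ξ x := by
  obtain ⟨η, rfl⟩ : ∃ η, rho cocycle t η = ξ :=
    ⟨star (rho cocycle t) ξ, by rw [← mul_apply_eq_comp, rho_mul_star]; rfl⟩
  have h : star (rho cocycle t) (rho cocycle t η) = η := by
    rw [← mul_apply_eq_comp, star_rho_mul]; rfl
  have hc : t⁻¹ * x = x * t⁻¹ := (cen_comm _ (inv_mem ht) x).symm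
  have hcc : comm t x = comm t (t⁻¹ * x) := by
    rw [comm_mul_right, comm_inv_right, comm_self, neg_zero, zero_add]
  rw [h, lam_apply, rho_apply, hcc, ← cocycle_mul_inv, ← mul_assoc, ← Circle.coe_mul, hc,
    inv_mul_cancel_right]

theorem rfin_apply_eq {η : L2 Grp} (hη : ∀ x ∉ cen, η x = 0) {f : Grp →₀ ℂ} {x : Grp}
    (hx : ∀ g ∈ f.support, comm x (1, g.2) = 0) :
    rfin cocycle f η x = ZMod.toCircle (tot (crd x) * deg x.1) * fin cocycle f η x := by
  rw [fin_apply, rfin_apply]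
  simp only [lp.coeFn_sum, Finset.sum_apply, lp.coeFn_smul, Pi.smul_apply, smul_eq_mul]
  rw [Finset.mul_sum]
  refine Finset.sum_congr rfl fun g hg => ?_
  rw [lam_apply, rho_apply]
  by_cases hgx : g⁻¹ * x ∈ cen
  · have hc : x * g⁻¹ = g⁻¹ * x := by
      have := cen_comm _ hgx g
      rw [mul_inv_cancel_left] at this
      rw [mul_inv_eq_iff_eq_mul, ← this]
    have hx1 : x.1 = g.1 := by
      have := mem_cen.1 hgx
      exact (inv_mul_eq_one.1 this).symm
    have hg' : comm (g⁻¹ * x) g = tot (crd x) * deg x.1 := by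
      have e : g = (g.1, 1) * (1, g.2) := Prod.ext (mul_one _).symm (one_mul _).symm
      rw [comm_mul_left, comm_inv_left, comm_self, neg_zero, zero_add, e, comm_mul_right, hx g hg,
        add_zero, hx1, comm, expo, expo]
      have : crd ((g.1, 1) : Grp) = 0 := rfl
      rw [this]
      simp
    rw [hc, ← hg', ← cocycle_mul_inv, Circle.coe_mul, Circle.coe_inv]
    have := Circle.coe_ne_zero (cocycle g (g⁻¹ * x))
    field_simp
  · have hgx' : x * g⁻¹ ∉ cen := fun h => hgx <| by
      have := cen_comm _ h g
      rw [inv_mul_cancel_right] at this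
      rwa [← inv_mul_eq_iff_eq_mul.2 this.symm] at h
    rw [hη _ hgx, hη _ hgx']
    simp

theorem exists_gap : ∃ κ > 0, ∀ z : ZMod 9, z ≠ 0 → κ ≤ ‖(ZMod.toCircle z : ℂ) - 1‖ := by
  classical
  have h : (Finset.univ.erase (0 : ZMod 9)).Nonempty := by decide
  refine ⟨(Finset.univ.erase (0 : ZMod 9)).inf' h
    fun z => ‖(ZMod.toCircle z : ℂ) - 1‖, ?_, fun z hz => Finset.inf'_le _ (by simpa using hz)⟩
  refine (Finset.lt_inf'_iff h).2 fun z hz => ?_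
  refine norm_pos_iff.2 (sub_ne_zero.2 fun h => (Finset.ne_of_mem_erase hz) ?_)
  rw [← Circle.coe_one, ← AddChar.map_zero_eq_one (ZMod.toCircle (N := 9))] at h
  exact ZMod.injective_toCircle (Circle.coe_injective h)

theorem mul_add_one_ne_zero : ∀ a b : ZMod 9, 3 * (a - b) = 0 → a * b + 1 ≠ 0 := by
  decide

theorem norm_rfin_sub_le {a V W : L2 Grp →L[ℂ] L2 Grp} (hV : V ∈ redAlg cocycle)
    (hW : W ∈ redAlg cocycle) (hV1 : star V * V = 1) (hV2 : V * star V = 1)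
    (hW2 : W * star W = 1) {f : Grp →₀ ℂ} {η x : L2 Grp} {B ε ε₁ ε₂ : ℝ}
    (hB : ‖fin cocycle f‖ ≤ B) (hf : ‖star V * a - fin cocycle f‖ ≤ ε)
    (hη : ‖η - (star W * V) (delta Grp)‖ ≤ ε₂) (hx : ‖a (delta Grp) - x‖ ≤ ε₁) :
    ‖rfin cocycle f η - star W x‖ ≤ B * ε₂ + ε + ε₁ := by
  have hWi : ∀ ξ, ‖star W ξ‖ = ‖ξ‖ := norm_apply_of_star_mul_self (by rw [star_star, hW2])
  have hVi := norm_apply_of_star_mul_self hV1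
  have hy : star W * V ∈ redAlg cocycle := mul_mem (star_mem hW) hV
  have e : rfin cocycle f η - star W x = rfin cocycle f (η - (star W * V) (delta Grp)) -
      (star W * V) ((star V * a - fin cocycle f) (delta Grp)) +
      star W (a (delta Grp) - x) := by
    have h1 : star W (a (delta Grp)) = (star W * V) ((star V * a) (delta Grp)) := by
      rw [← mul_apply_eq_comp, ← mul_apply_eq_comp, mul_assoc, ← mul_assoc V, hV2, one_mul]
    rw [map_sub, map_sub, sub_apply, map_sub, rfin_apply_delta hy, h1]
    abel
  rw [e]
  refine (norm_add_le _ _).trans (add_le_add ((norm_sub_le _ _).trans (add_le_add ?_ ?_)) ?_)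
  · exact (norm_rfin_le _ _).trans (mul_le_mul hB hη (norm_nonneg _) ((norm_nonneg _).trans hB))
  · rw [mul_apply_eq_comp, hWi, hVi]
    refine ((star V * a - fin cocycle f).le_opNorm _).trans ?_
    rwa [norm_delta, mul_one]
  · rwa [hWi]

theorem norm_fin_sub_le {a V W : L2 Grp →L[ℂ] L2 Grp} (ha : a ∈ redAlg cocycle)
    (hV : V ∈ redAlg cocycle) (hW : W ∈ redAlg cocycle) (hV1 : star V * V = 1)
    (hV2 : V * star V = 1) (hW2 : W * star W = 1) {q : ℂ} (hq : ‖q‖ = 1) {f : Grp →₀ ℂ}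
    {η x : L2 Grp} {B ε ε₁ ε₂ : ℝ} (hB : ‖fin cocycle f‖ ≤ B)
    (hf : ‖star V * a - fin cocycle f‖ ≤ ε)
    (hη : ‖η - (star W * V) (delta Grp)‖ ≤ ε₂) (hx : ‖a (delta Grp) - x‖ ≤ ε₁)
    (hcomm : ‖star W * V * a - a * (star W * V)‖ ≤ ε)
    (hq' : ‖(W * V - q • (V * W)) (delta Grp)‖ ≤ ε) :
    ‖fin cocycle f η - conj q • star W x‖ ≤ B * ε₂ + ε + ε + ε * ‖a‖ + ε₁ := by
  have hWi : ∀ ξ, ‖star W ξ‖ = ‖ξ‖ := norm_apply_of_star_mul_self (by rw [star_star, hW2])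
  have hVsi : ∀ ξ, ‖star V ξ‖ = ‖ξ‖ := norm_apply_of_star_mul_self (by rw [star_star, hV2])
  have hVi := norm_apply_of_star_mul_self hV1
  have hc : W * V - q • (V * W) ∈ redAlg cocycle :=
    sub_mem (mul_mem hW hV) (SMulMemClass.smul_mem _ (mul_mem hV hW))
  set y := star W * V with hy
  have h1 : star (W * V - q • (V * W)) * (V * a) = star V * y * a - conj q • (star W * a) := by
    rw [star_sub, star_smul, star_mul, star_mul, sub_mul, smul_mul_assoc, mul_assoc (star W),
      ← mul_assoc (star V) V, hV1, one_mul, hy]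
    simp only [mul_assoc]
    rfl
  have e : fin cocycle f η - conj q • star W x = fin cocycle f (η - y (delta Grp)) -
      (star V * a - fin cocycle f) (y (delta Grp)) -
      star V ((y * a - a * y) (delta Grp)) +
      (star (W * V - q • (V * W)) * (V * a)) (delta Grp) +
      conj q • star W (a (delta Grp) - x) := by
    rw [h1]
    simp only [map_sub, sub_apply, smul_apply, mul_apply_eq_comp, smul_sub]
    abel
  rw [e]
  refine (norm_add_le _ _).trans (add_le_add ((norm_add_le _ _).trans (add_le_add
    ((norm_sub_le _ _).trans (add_le_add ((norm_sub_le _ _).trans (add_le_add ?_ ?_)) ?_)) ?_)) ?_)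
  · exact ((fin cocycle f).le_opNorm _).trans
      (mul_le_mul hB hη (norm_nonneg _) ((norm_nonneg _).trans hB))
  · refine ((star V * a - fin cocycle f).le_opNorm _).trans ?_
    rwa [hy, mul_apply_eq_comp, hWi, hVi, norm_delta, mul_one]
  · rw [hVsi]
    refine ((y * a - a * y).le_opNorm _).trans ?_
    rwa [norm_delta, mul_one]
  · refine (norm_mul_delta_le (star_mem hc) (mul_mem hV ha)).trans ?_
    rw [norm_star_delta hc]
    refine mul_le_mul hq' ?_ (norm_nonneg _) ((norm_nonneg _).trans hq')
    refine ContinuousLinearMap.opNorm_le_bound _ (norm_nonneg _) fun ξ => ?_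
    rw [mul_apply_eq_comp, hVi]
    exact a.le_opNorm ξ
  · rwa [norm_smul, RCLike.norm_conj, hq, one_mul, hWi]

theorem norm_le_of_comm_tgen {κ : ℝ}
    (hκ : ∀ z : ZMod 9, z ≠ 0 → κ ≤ ‖(ZMod.toCircle z : ℂ) - 1‖)
    {η s : L2 Grp} (hη : ∀ x ∉ cen, η x = 0) {f : Grp →₀ ℂ} {x : Grp}
    (ht : comm x tgen = 0) (hx : ∀ g ∈ f.support, comm x (1, g.2) = 0) :
    κ * ‖s x‖ ≤ ‖(rfin cocycle f η - s) x‖ +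
      ‖(fin cocycle f η - (ZMod.toCircle (1 : ZMod 9) : ℂ) • s) x‖ := by
  rw [comm_tgen] at ht
  have hz := hκ _ (mul_add_one_ne_zero _ _ ht)
  set v := tot (crd x) * deg x.1
  have e : ((ZMod.toCircle (v + 1) : ℂ) - 1) * s x = (rfin cocycle f η - s) x -
      ZMod.toCircle v * (fin cocycle f η - (ZMod.toCircle (1 : ZMod 9) : ℂ) • s) x := by
    rw [lp.coeFn_sub, lp.coeFn_sub, Pi.sub_apply, Pi.sub_apply, lp.coeFn_smul, Pi.smul_apply,
      rfin_apply_eq hη hx, AddChar.map_add_eq_mul, Circle.coe_mul, smul_eq_mul]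
    ring
  calc κ * ‖s x‖ ≤ ‖((ZMod.toCircle (v + 1) : ℂ) - 1) * s x‖ := by
        rw [norm_mul]
        exact mul_le_mul_of_nonneg_right hz (norm_nonneg _)
    _ ≤ _ := by
        rw [e]
        refine (norm_sub_le _ _).trans ?_
        rw [norm_mul, Circle.norm_coe, one_mul]

theorem norm_le_of_approx {κ : ℝ} (hκ0 : 0 < κ)
    (hκ : ∀ z : ZMod 9, z ≠ 0 → κ ≤ ‖(ZMod.toCircle z : ℂ) - 1‖)
    {η s : L2 Grp} (hη : ∀ x ∉ cen, η x = 0) {f : Grp →₀ ℂ} {T : Finset Grp}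
    (hTc : ∀ t ∈ T, t ∈ cen) (ht : tgen ∈ T) (hT : ∀ g ∈ f.support, ((1, g.2) : Grp) ∈ T) :
    κ * ‖s‖ ≤ ‖rfin cocycle f η - s‖ +
      ‖fin cocycle f η - (ZMod.toCircle (1 : ZMod 9) : ℂ) • s‖ +
      ∑ t ∈ T, ‖lam cocycle t (star (rho cocycle t) s) - s‖ := by
  have key := L2.norm_le_sum (ξ := (κ : ℂ) • s)
    (γ := fun o : Option (Option T) => o.elim (rfin cocycle f η - s) fun o =>
      o.elim (fin cocycle f η - (ZMod.toCircle (1 : ZMod 9) : ℂ) • s) fun t =>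
        lam cocycle t (star (rho cocycle t) s) - s) Finset.univ ?_
  · rw [Fintype.sum_option, Fintype.sum_option, norm_smul, Complex.norm_real,
      Real.norm_of_nonneg hκ0.le, ← add_assoc] at key
    rw [← Finset.sum_coe_sort T]
    exact key
  · intro x
    rw [Fintype.sum_option, Fintype.sum_option, lp.coeFn_smul, Pi.smul_apply, norm_smul,
      Complex.norm_real, Real.norm_of_nonneg hκ0.le, ← add_assoc]
    simp only [Option.elim]
    by_cases hx : ∀ t ∈ T, comm x t = 0
    · exact (norm_le_of_comm_tgen hκ hη (hx _ ht) fun g hg => hx _ (hT g hg)).trans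
        (le_add_of_nonneg_right (Finset.sum_nonneg fun _ _ => norm_nonneg _))
    · push Not at hx
      obtain ⟨t, htT, hne⟩ := hx
      refine le_trans ?_ (le_add_of_nonneg_left (add_nonneg (norm_nonneg _) (norm_nonneg _)))
      refine le_trans ?_ (Finset.single_le_sum (fun _ _ => norm_nonneg _)
        (Finset.mem_univ (⟨t, htT⟩ : T)))
      rw [lp.coeFn_sub, Pi.sub_apply, conj_cen_apply (hTc t htT), ← sub_one_mul, norm_mul]
      refine mul_le_mul_of_nonneg_right (hκ _ ?_) (norm_nonneg _)
      rwa [comm_swap, neg_ne_zero]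

theorem not_asympSeq_conj (w : ℕ → Alg) :
    ¬ AsympSeq (conj (ZMod.toCircle (1 : ZMod 9) : ℂ)) w := by
  intro hw
  obtain ⟨κ, hκ0, hκ⟩ := exists_gap
  obtain ⟨x, hx, hinv⟩ := exists_vector_of_asympSeq hw
  obtain ⟨fa, hfa⟩ := exists_fin_delta_near x (show 0 < κ / 8 by positivity)
  set a := fin cocycle fa with ha
  have ham : a ∈ redAlg cocycle := fin_mem _ _
  set A := ‖a‖ with hA
  have hA0 : 0 ≤ A := norm_nonneg _
  set D := 24 * (A + 1) + 3 + A with hD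
  have hD0 : 0 < D := by positivity
  set ε := min 1 (κ / (4 * D)) with hε
  have hε0 : 0 < ε := by positivity
  have hε1 : ε ≤ 1 := min_le_left _ _
  have hεD : D * ε ≤ κ / 4 := by
    have := mul_le_mul_of_nonneg_left (min_le_right 1 (κ / (4 * D))) hD0.le
    refine this.trans (le_of_eq ?_)
    field_simp
  obtain ⟨N₀, hN₀⟩ := hw.cauchy ⟨a, ham⟩ ε hε0
  obtain ⟨N₁, hN₁⟩ := hw.cauchy (unt (fgen 0 1)) ε hε0
  obtain ⟨N₂, hN₂⟩ := hw.cauchy (unt (fgen 1 1)) ε hε0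
  obtain ⟨N₃, hN₃⟩ := hw.comm ε hε0
  obtain ⟨n, hn₀, hn₁, hn₂, hn₃⟩ : ∃ n, N₀ ≤ n ∧ N₁ ≤ n ∧ N₂ ≤ n ∧ N₃ ≤ n :=
    ⟨N₀ + N₁ + N₂ + N₃, by omega, by omega, by omega, by omega⟩
  obtain ⟨M, hM⟩ := hN₃ n hn₃
  obtain ⟨f, hf⟩ := exists_fin_near cocycle
    (mul_mem (star_mem (w n).2) ham) hε0
  classical
  set T : Finset Grp := insert tgen (f.support.image fun g => ((1, g.2) : Grp)) with hT
  have hTc : ∀ t ∈ T, t ∈ cen := by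
    intro t ht
    rcases Finset.mem_insert.1 ht with rfl | ht
    · exact tgen_mem
    · obtain ⟨g, -, rfl⟩ := Finset.mem_image.1 ht
      exact rfl
  have hTcard : (0 : ℝ) < T.card := by
    exact_mod_cast Finset.card_pos.2 ⟨tgen, Finset.mem_insert_self _ _⟩
  choose! N hN using fun t ht => hinv t (hTc t ht) (κ / (4 * T.card)) (by positivity)
  obtain ⟨m, hmM, hmn, hmT⟩ : ∃ m, M ≤ m ∧ n ≤ m ∧ ∀ t ∈ T, N t ≤ m :=
    ⟨M + n + T.sup N, by omega, by omega, fun t ht => (Finset.le_sup ht).trans (by omega)⟩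
  have hconj : ∀ c : Alg, ‖w m * c * star (w m) - w n * c * star (w n)‖ ≤ ε →
      ‖star (w m) * w n * c - c * (star (w m) * w n)‖ ≤ ε := by
    intro c hc
    have e : star (w m) * w n * c - c * (star (w m) * w n) =
        -(star (w m) * (w m * c * star (w m) - w n * c * star (w n)) * w n) := by
      have h1 := hw.star_mul m
      have h2 := hw.star_mul n
      have e1 : star (w m) * (w m * c * star (w m)) * w n =
          (star (w m) * w m) * c * (star (w m) * w n) := by simp only [mul_assoc]
      have e2 : star (w m) * (w n * c * star (w n)) * w n =
          star (w m) * w n * c * (star (w n) * w n) := by simp only [mul_assoc]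
      rw [mul_sub, sub_mul, e1, e2, h1, h2, mul_one, one_mul, neg_sub]
    have hle : ∀ k, ‖w k‖ ≤ 1 := fun k => by
      refine ContinuousLinearMap.opNorm_le_bound _ zero_le_one fun ξ => ?_
      rw [one_mul]
      exact (norm_apply_of_star_mul_self (congrArg Subtype.val (hw.star_mul k)) ξ).le
    rw [e, norm_neg]
    refine (norm_mul_le _ _).trans ?_
    refine (mul_le_of_le_one_right (norm_nonneg _) (hle n)).trans ?_
    refine (norm_mul_le _ _).trans ?_
    rw [norm_star]
    exact (mul_le_of_le_one_left (norm_nonneg _) (hle m)).trans hc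
  have h0 := hconj ⟨a, ham⟩ (hN₀ m (hn₀.trans hmn) n hn₀)
  have h1 := hconj _ (hN₁ m (hn₁.trans hmn) n hn₁)
  have h2 := hconj _ (hN₂ m (hn₂.trans hmn) n hn₂)
  have h3 := hM m hmM
  have hV1 : star (w n : L2 Grp →L[ℂ] L2 Grp) * w n = 1 := congrArg Subtype.val (hw.star_mul n)
  have hV2 : (w n : L2 Grp →L[ℂ] L2 Grp) * star (w n : L2 Grp →L[ℂ] L2 Grp) = 1 :=
    congrArg Subtype.val (hw.mul_star n)
  have hW2 : (w m : L2 Grp →L[ℂ] L2 Grp) * star (w m : L2 Grp →L[ℂ] L2 Grp) = 1 :=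
    congrArg Subtype.val (hw.mul_star m)
  have hV := (w n).2
  have hW := (w m).2
  have hs : ∀ t ∈ T, _ := fun t ht => hN t ht m (hmT t ht)
  change ‖star (w m : L2 Grp →L[ℂ] L2 Grp) * (w n : L2 Grp →L[ℂ] L2 Grp) * a -
    a * (star (w m : L2 Grp →L[ℂ] L2 Grp) * (w n : L2 Grp →L[ℂ] L2 Grp))‖ ≤ ε at h0
  change ‖star (w m : L2 Grp →L[ℂ] L2 Grp) * (w n : L2 Grp →L[ℂ] L2 Grp) *
    lam cocycle (fgen 0 1) - lam cocycle (fgen 0 1) *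
    (star (w m : L2 Grp →L[ℂ] L2 Grp) * (w n : L2 Grp →L[ℂ] L2 Grp))‖ ≤ ε at h1
  change ‖star (w m : L2 Grp →L[ℂ] L2 Grp) * (w n : L2 Grp →L[ℂ] L2 Grp) *
    lam cocycle (fgen 1 1) - lam cocycle (fgen 1 1) *
    (star (w m : L2 Grp →L[ℂ] L2 Grp) * (w n : L2 Grp →L[ℂ] L2 Grp))‖ ≤ ε at h2
  change ‖((w m : L2 Grp →L[ℂ] L2 Grp) * (w n : L2 Grp →L[ℂ] L2 Grp) -
    conj (ZMod.toCircle (1 : ZMod 9) : ℂ) • ((w n : L2 Grp →L[ℂ] L2 Grp) *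
      (w m : L2 Grp →L[ℂ] L2 Grp))) (delta Grp)‖ ≤ ε at h3
  generalize (w n : L2 Grp →L[ℂ] L2 Grp) = V at *
  generalize (w m : L2 Grp →L[ℂ] L2 Grp) = W at *
  have hy : star W * V ∈ redAlg cocycle := mul_mem (star_mem hW) hV
  have hbound : ∀ c : L2 Grp →L[ℂ] L2 Grp, ‖c‖ ≤ ε → ‖c (delta Grp)‖ ≤ ε := fun c hc => by
    refine (c.le_opNorm _).trans ?_
    rwa [norm_delta, mul_one]
  have hoff := norm_res_compl_cen_le ((norm_conj_sub_le hy _).trans (hbound _ h1))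
    ((norm_conj_sub_le hy _).trans (hbound _ h2))
  set η := res (cen : Set Grp) ((star W * V) (delta Grp)) with hη
  have hη0 : ∀ x ∉ cen, η x = 0 := fun x hx => res_apply_of_notMem hx _
  have hη1 : ‖η - (star W * V) (delta Grp)‖ ≤ 12 * ε := by
    refine le_trans (le_of_eq ?_) hoff
    rw [← norm_neg, neg_sub]
    congr 1
    ext x
    by_cases hx : x ∈ (cen : Set Grp) <;> simp [hη, res_apply, hx]
  have hB : ‖fin cocycle f‖ ≤ A + 1 := by
    have hVa : ‖star V * a‖ ≤ A := by
      refine ContinuousLinearMap.opNorm_le_bound _ hA0 fun ξ => ?_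
      rw [mul_apply_eq_comp, norm_apply_of_star_mul_self (by rw [star_star, hV2])]
      exact a.le_opNorm ξ
    have := norm_sub_norm_le (fin cocycle f) (star V * a)
    rw [norm_sub_rev] at this
    linarith
  have k1 := norm_rfin_sub_le hV hW hV1 hV2 hW2 hB hf.le hη1 hfa
  have k2 := norm_fin_sub_le ham hV hW hV1 hV2 hW2
    (q := conj (ZMod.toCircle (1 : ZMod 9) : ℂ)) (by rw [RCLike.norm_conj, Circle.norm_coe]) hB
    hf.le hη1 hfa h0 h3
  rw [Complex.conj_conj] at k2
  have k3 := norm_le_of_approx hκ0 hκ (s := star W x) hη0 (f := f) (T := T) hTc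
    (Finset.mem_insert_self _ _)
    fun g hg => Finset.mem_insert_of_mem (Finset.mem_image_of_mem _ hg)
  have k4 : ∑ t ∈ T, ‖lam cocycle t (star (rho cocycle t) (star W x)) - star W x‖ ≤ κ / 4 := by
    refine (Finset.sum_le_sum hs).trans (le_of_eq ?_)
    rw [Finset.sum_const, nsmul_eq_mul]
    field_simp
  rw [norm_apply_of_star_mul_self (by rw [star_star, hW2]), hx, mul_one] at k3
  rw [hD] at hεD
  linarith

end Rigidity

end TwistedGroup

/-- There exists a simple separable unital C*-algebra `A` admitting no conjugate-linear
*-automorphism, i.e. no additive bijection `φ : A → A` which is multiplicative,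
star-preserving, and satisfies `φ (c • x) = (conj c) • φ x` for all `c : ℂ`.
(In particular such an `A` is not isomorphic to the complexification of any real
C*-algebra.) -/
theorem exists_simple_separable_cstarAlgebra_no_conjugate_linear_automorphism :
    ∃ (A : Type) (_ : CStarAlgebra A),
      TopologicalSpace.SeparableSpace A ∧
      (∀ I : TwoSidedIdeal A, IsClosed (I : Set A) → I = ⊥ ∨ I = ⊤) ∧
      ¬ ∃ φ : A → A, Function.Bijective φ ∧
          (∀ x y : A, φ (x + y) = φ x + φ y) ∧
          (∀ x y : A, φ (x * y) = φ x * φ y) ∧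
          (∀ x : A, φ (star x) = star (φ x)) ∧
          (∀ (c : ℂ) (x : A), φ (c • x) = (starRingEnd ℂ c) • φ x) := by
  refine ⟨TwistedGroup.Alg, inferInstance, TwistedGroup.separableSpace_alg,
    TwistedGroup.twoSidedIdeal_eq, ?_⟩
  rintro ⟨φ, hbij, hadd, hmul, hstar, hsmul⟩
  exact TwistedGroup.not_asympSeq_conj _
    (TwistedGroup.asympSeq_unt.map hbij hadd hmul hstar hsmul)
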